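/- Let G be a simple graph that is not cyclically connected. Then |G| is 5-arc connected if and only if |G| is homeomorphic to one of the following spaces: the closed interval [0,1]; the half-open interval [0,1); the real line ℝ; the lollipop (the union in ℝ² of the unit circle and the segment from (1,0) to (2,0)); the lollipop with its free endpoint (2,0) removed; the dumbbell (the union in ℝ² of the circles of radius 1 centered at (−2,0) and (2,0) and the segment from (−1,0) to (1,0)); or the figure-eight (the union in ℝ² of the circles of radius 1 centered at (−1,0) and (1,0), which meet exactly at the origin). -/

import Mathlib

open Topology

noncomputable section

variable {V : Type*}

open Classical in
/-- The Dirac function marking a vertex: the point of `|G|` corresponding to vertex `v`. -/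
noncomputable def vertexPoint (v : V) : V → ℝ := fun u => if u = v then 1 else 0

open Classical in
/-- The point of `|G|` lying on the edge `vw` at parameter `t` (measured from `v` towards `w`). -/
noncomputable def edgePoint (v w : V) (t : ℝ) : V → ℝ :=
  fun u => (if u = v then 1 - t else 0) + (if u = w then t else 0)

/-- The geometric realization `|G|` of a simple graph `G`, realized as the set of
formal convex combinations of adjacent pairs of vertices; each closed edge carries
its usual topology as a copy of `[0,1]`. -/
def GraphRealization (G : SimpleGraph V) : Set (V → ℝ) :=
  {x | (∃ v, x = vertexPoint v) ∨
    ∃ v w t, G.Adj v w ∧ t ∈ Set.Icc (0 : ℝ) 1 ∧ x = edgePoint v w t}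

/-- A subset of a topological space is an arc if it is homeomorphic to `[0,1]`. -/
def IsArc {X : Type*} [TopologicalSpace X] (A : Set X) : Prop :=
  Nonempty (↥A ≃ₜ ↥unitInterval)

/-- A space is `n`-arc connected if any at most `n` points lie on a common arc. -/
def NArcConn (X : Type*) [TopologicalSpace X] (n : ℕ) : Prop :=
  ∀ S : Finset X, S.card ≤ n → ∃ A : Set X, IsArc A ∧ ↑S ⊆ A

/-- The unit circle in the plane. -/
def unitCircleSet : Set (ℝ × ℝ) := {p | p.1 ^ 2 + p.2 ^ 2 = 1}

/-- A subset of a topological space is a simple closed curve if homeomorphic to the circle. -/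
def IsSimpleClosedCurve {X : Type*} [TopologicalSpace X] (C : Set X) : Prop :=
  Nonempty (↥C ≃ₜ ↥unitCircleSet)

/-- A space is `n`-circle connected if any at most `n` points lie on a common
simple closed curve. -/
def NCircleConn (X : Type*) [TopologicalSpace X] (n : ℕ) : Prop :=
  ∀ S : Finset X, S.card ≤ n → ∃ C : Set X, IsSimpleClosedCurve C ∧ ↑S ⊆ C

/-- A space is `n`-strongly arc connected if any list of at most `n` points is contained
in an arc, the points appearing along the arc in the listed order. -/
def NStrongArcConn (X : Type*) [TopologicalSpace X] (n : ℕ) : Prop :=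
  ∀ l : List X, l.length ≤ n →
    ∃ f : ↥unitInterval → X, Topology.IsEmbedding f ∧
      ∃ t : Fin l.length → ↥unitInterval, Monotone t ∧ ∀ i, f (t i) = l.get i

/-- A graph is `k`-connected if removing fewer than `k` vertices leaves it connected. -/
def KConnected (G : SimpleGraph V) (k : ℕ) : Prop :=
  ∀ S : Set V, S.encard < (k : ℕ∞) → (G.induce (Sᶜ : Set V)).Connected

/-- A graph is cyclically connected if any two vertices lie on a common cycle. -/
def CyclicallyConnected (G : SimpleGraph V) : Prop :=
  ∀ v w : V, ∃ (u : V) (c : G.Walk u u), c.IsCycle ∧ v ∈ c.support ∧ w ∈ c.support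

/-- The circle of radius `r` centered at `c` in the plane. -/
def circleAt (c : ℝ × ℝ) (r : ℝ) : Set (ℝ × ℝ) :=
  {p | (p.1 - c.1) ^ 2 + (p.2 - c.2) ^ 2 = r ^ 2}

/-- The horizontal segment at height `y` from abscissa `a` to `b`. -/
def hSeg (y a b : ℝ) : Set (ℝ × ℝ) := {p | p.2 = y ∧ a ≤ p.1 ∧ p.1 ≤ b}

/-- The θ-curve: unit circle together with horizontal diameter. -/
def thetaSet : Set (ℝ × ℝ) := circleAt (0, 0) 1 ∪ hSeg 0 (-1) 1

/-- Figure-eight: two unit circles meeting at the origin. -/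
def figureEightSet : Set (ℝ × ℝ) := circleAt (-1, 0) 1 ∪ circleAt (1, 0) 1

/-- Lollipop: unit circle with the segment from `(1,0)` to `(2,0)` attached. -/
def lollipopSet : Set (ℝ × ℝ) := circleAt (0, 0) 1 ∪ hSeg 0 1 2

/-- Lollipop with its free endpoint removed. -/
def openLollipopSet : Set (ℝ × ℝ) := lollipopSet \ {(2, 0)}

/-- Dumbbell: two disjoint unit circles joined by a segment. -/
def dumbbellSet : Set (ℝ × ℝ) := circleAt (-2, 0) 1 ∪ circleAt (2, 0) 1 ∪ hSeg 0 (-1) 1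

/-- Happy-face curve: two circles meeting at a point, joined by a further arc. -/
def happyFaceSet : Set (ℝ × ℝ) :=
  circleAt (-1, 0) 1 ∪ circleAt (1, 0) 1 ∪ {p | p.1 ^ 2 + p.2 ^ 2 = 4 ∧ p.2 ≤ 0}

/-- Baguette curve: two disjoint circles joined by two disjoint arcs. -/
def baguetteSet : Set (ℝ × ℝ) :=
  circleAt (-3, 0) 1 ∪ circleAt (3, 0) 1 ∪ hSeg 0 (-2) 2 ∪ hSeg 1 (-3) 3

/-- A graph is a basic 4-ac graph iff its realization is homeomorphic to a circle,
a θ-curve, a happy-face curve or a baguette curve (this captures precisely the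
subdivisions of those four graphs). -/
def IsBasicFourAC {W : Type*} (H : SimpleGraph W) : Prop :=
  Nonempty (↥(GraphRealization H) ≃ₜ ↥unitCircleSet) ∨
  Nonempty (↥(GraphRealization H) ≃ₜ ↥thetaSet) ∨
  Nonempty (↥(GraphRealization H) ≃ₜ ↥happyFaceSet) ∨
  Nonempty (↥(GraphRealization H) ≃ₜ ↥baguetteSet)

/-- A chain-graph decomposition of the connected graph `G`: links indexed by an
interval `J` of `ℤ`, non-consecutive links are disjoint, consecutive links share
exactly one vertex. -/
structure IsChainGraph (G : SimpleGraph V) (J : Set ℤ) (L : ℤ → G.Subgraph) : Prop where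
  connected : G.Connected
  ordConnected : J.OrdConnected
  nonempty : J.Nonempty
  cover : (⨆ i ∈ J, L i) = (⊤ : G.Subgraph)
  sep : ∀ i ∈ J, ∀ j ∈ J, i + 1 < j → (L i).verts ∩ (L j).verts = ∅
  link : ∀ i ∈ J, i + 1 ∈ J → ∃ v, (L i).verts ∩ (L (i + 1)).verts = {v}

/-- A cut-vertex: a vertex whose removal disconnects the graph. -/
def IsCutVertex (G : SimpleGraph V) (v : V) : Prop :=
  ¬ (G.induce ({v}ᶜ : Set V)).Connected

/-- A block: a maximal 2-connected subgraph. -/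
def IsBlock (G : SimpleGraph V) (H : G.Subgraph) : Prop :=
  KConnected H.coe 2 ∧ ∀ H' : G.Subgraph, H ≤ H' → KConnected H'.coe 2 → H' = H

/-- The block graph of `G`: the bipartite graph on cut-vertices and blocks, a cut-vertex
being adjacent to the blocks containing it. -/
def BlockGraph (G : SimpleGraph V) :
    SimpleGraph ({v : V // IsCutVertex G v} ⊕ {H : G.Subgraph // IsBlock G H}) :=
  SimpleGraph.fromRel fun a b =>
    ∃ (c : {v : V // IsCutVertex G v}) (B : {H : G.Subgraph // IsBlock G H}),
      a = Sum.inl c ∧ b = Sum.inr B ∧ (c : V) ∈ (B : G.Subgraph).verts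

/-- An `A`–`B` path: a path starting in `A`, ending in `B` and meeting `A ∪ B` only
in these two endvertices. -/
structure ABPath (G : SimpleGraph V) (A B : Set V) where
  first : V
  last : V
  walk : G.Walk first last
  isPath : walk.IsPath
  firstA : first ∈ A
  lastB : last ∈ B
  meetA : ∀ v ∈ walk.support, v ∈ A → v = first
  meetB : ∀ v ∈ walk.support, v ∈ B → v = last

/-- A family of pairwise vertex-disjoint paths. -/
def PathFamilyDisjoint {G : SimpleGraph V} {A B : Set V} {k : ℕ}
    (P : Fin k → ABPath G A B) : Prop :=
  ∀ i j, i ≠ j → ∀ v, v ∈ (P i).walk.support → v ∉ (P j).walk.support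

/-- The set of vertices used by a family of paths. -/
def familySupport {G : SimpleGraph V} {A B : Set V} {k : ℕ}
    (P : Fin k → ABPath G A B) : Set V :=
  {v | ∃ i, v ∈ (P i).walk.support}

/-- The set of edges used by a family of paths. -/
def familyEdges {G : SimpleGraph V} {A B : Set V} {k : ℕ}
    (P : Fin k → ABPath G A B) : Set (Sym2 V) :=
  {e | ∃ i, e ∈ (P i).walk.edges}

/-- A walk `W` (with no repeated edges) is alternating with respect to the disjoint
path family `P`: it starts in `A` off the paths; repeated vertices lie on paths of the
family; upon hitting a path by a new edge it follows that path backwards for at least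
one edge; and it traverses edges of paths of the family only backwards. -/
structure IsAlternatingWalk {G : SimpleGraph V} {A B : Set V} {k : ℕ}
    (P : Fin k → ABPath G A B) {x y : V} (W : G.Walk x y) : Prop where
  trail : W.IsTrail
  startA : x ∈ A
  startOff : x ∉ familySupport P
  repeats : ∀ v, List.Duplicate v W.support → v ∈ familySupport P
  follows : ∀ (i : ℕ) (hi : i < W.darts.length) (j : Fin k),
      (W.darts.get ⟨i, hi⟩).snd ∈ (P j).walk.support →
      (W.darts.get ⟨i, hi⟩).edge ∉ (P j).walk.edges →
      ∃ h : i + 1 < W.darts.length, (W.darts.get ⟨i + 1, h⟩).symm ∈ (P j).walk.darts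
  backward : ∀ d ∈ W.darts, ∀ j : Fin k,
      d.edge ∈ (P j).walk.edges → d.symm ∈ (P j).walk.darts

end

/-- A traversal of a space by a closed set of real parameters: a continuous, surjective map
under which every point has a neighbourhood with bounded preimage. -/
structure IsTraversal {X : Type*} [TopologicalSpace X] (J : Set ℝ) (f : ℝ → X) : Prop where
  continuousOn : ContinuousOn f J
  surjOn : ∀ x, ∃ s ∈ J, f s = x
  bounded : ∀ x, ∃ U ∈ 𝓝 x, ∃ N : ℝ, ∀ s ∈ J, f s ∈ U → |s| ≤ N

theorem IsTraversal.isQuotientMap {X : Type*} [TopologicalSpace X] [T2Space X] {J : Set ℝ}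
    {f : ℝ → X} (hf : IsTraversal J f) (hJ : IsClosed J) :
    IsQuotientMap (J.domRestrict f) := by
  have hc : Continuous (J.domRestrict f) :=
    continuousOn_iff_continuous_domRestrict.1 hf.continuousOn
  refine IsClosedMap.isQuotientMap ?_ hc ?_
  · intro C hC
    refine isClosed_of_closure_subset fun y hy => ?_
    obtain ⟨U, hU, N, hN⟩ := hf.bounded y
    have hcomp : IsCompact (J.domRestrict f '' (C ∩ (Subtype.val ⁻¹' Set.Icc (-N) N))) := by
      refine IsCompact.image ?_ hc
      refine IsCompact.inter_left ?_ hC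
      exact hJ.isClosedEmbedding_subtypeVal.isCompact_preimage isCompact_Icc
    have h1 : y ∈ closure (J.domRestrict f '' C ∩ U) :=
      mem_closure_iff_nhds.2 fun T hT => by
        obtain ⟨z, hz, hz'⟩ := mem_closure_iff_nhds.1 hy _ (Filter.inter_mem hT hU)
        exact ⟨z, hz.1, hz', hz.2⟩
    have h2 : J.domRestrict f '' C ∩ U ⊆
        J.domRestrict f '' (C ∩ (Subtype.val ⁻¹' Set.Icc (-N) N)) := by
      rintro _ ⟨⟨s, hs, rfl⟩, hsU⟩
      exact ⟨s, ⟨hs, abs_le.1 (hN s s.2 hsU)⟩, rfl⟩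
    have h3 := hcomp.isClosed.closure_subset_iff.2 h2 h1
    exact Set.image_mono Set.inter_subset_left h3
  · intro x
    obtain ⟨s, hs, rfl⟩ := hf.surjOn x
    exact ⟨⟨s, hs⟩, rfl⟩

/-- Two spaces traversed with the same identifications are homeomorphic. -/
theorem IsTraversal.nonempty_homeomorph {X Y : Type*} [TopologicalSpace X] [T2Space X]
    [TopologicalSpace Y] [T2Space Y] {J : Set ℝ} {f : ℝ → X} {g : ℝ → Y}
    (hf : IsTraversal J f) (hg : IsTraversal J g) (hJ : IsClosed J)
    (h : ∀ s ∈ J, ∀ t ∈ J, f s = f t ↔ g s = g t) : Nonempty (X ≃ₜ Y) := by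
  choose a ha ha' using hf.surjOn
  choose b hb hb' using hg.surjOn
  refine ⟨⟨⟨fun x => g (a x), fun y => f (b y), fun x => ?_, fun y => ?_⟩, ?_, ?_⟩⟩
  · have : f (b (g (a x))) = f (a x) := (h _ (hb _) _ (ha _)).2 (hb' _)
    exact this.trans (ha' x)
  · have : g (a (f (b y))) = g (b y) := (h _ (ha _) _ (hb _)).1 (ha' _)
    exact this.trans (hb' y)
  · refine (hf.isQuotientMap hJ).continuous_iff.2 ?_
    refine (hg.isQuotientMap hJ).continuous.congr fun s => ?_
    exact ((h _ (ha _) _ s.2).1 (ha' _)).symm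
  · refine (hg.isQuotientMap hJ).continuous_iff.2 ?_
    refine (hf.isQuotientMap hJ).continuous.congr fun s => ?_
    exact ((h _ (hb _) _ s.2).2 (hb' _)).symm

theorem IsTraversal.comp_orderIso {X : Type*} [TopologicalSpace X] {J : Set ℝ} {f : ℝ → X}
    (hf : IsTraversal J f) (e : ℝ ≃o ℝ) : IsTraversal (e ⁻¹' J) (f ∘ e) where
  continuousOn := hf.continuousOn.comp e.continuous.continuousOn fun _ h => h
  surjOn x := by
    obtain ⟨s, hs, rfl⟩ := hf.surjOn x
    exact ⟨e.symm s, by simpa using hs, by simp⟩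
  bounded x := by
    obtain ⟨U, hU, N, hN⟩ := hf.bounded x
    refine ⟨U, hU, max |e.symm N| |e.symm (-N)|, fun s hs hsU => ?_⟩
    obtain ⟨h1, h2⟩ := abs_le.1 (hN _ hs hsU)
    exact abs_le_max_abs_abs (e.symm_apply_le.2 h1) (e.le_symm_apply.2 h2)
      |>.trans (max_comm _ _).le

theorem IsTraversal.of_isCompact {X : Type*} [TopologicalSpace X] {a b : ℝ} {f : ℝ → X}
    (hc : ContinuousOn f (Set.Icc a b)) (hs : ∀ x, ∃ s ∈ Set.Icc a b, f s = x) :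
    IsTraversal (Set.Icc a b) f where
  continuousOn := hc
  surjOn := hs
  bounded _ := ⟨Set.univ, Filter.univ_mem, max |a| |b|, fun _ hs _ =>
    abs_le_max_abs_abs hs.1 hs.2⟩

/-- A continuous bijective image of an interval is `n`-arc connected for every `n`. -/
theorem nArcConn_of_injOn {X : Type*} [TopologicalSpace X] [T2Space X] {J : Set ℝ} {f : ℝ → X}
    (hJ : J.OrdConnected) {p q : ℝ} (hp : p ∈ J) (hq : q ∈ J) (hpq : p < q)
    (hc : ContinuousOn f J) (hi : Set.InjOn f J) (hs : ∀ x, ∃ s ∈ J, f s = x) (n : ℕ) :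
    NArcConn X n := by
  intro S _
  choose a ha ha' using hs
  set T : Finset ℝ := insert p (insert q (S.image a)) with hT
  have hne : T.Nonempty := ⟨p, by simp [hT]⟩
  have hTJ : ∀ t ∈ T, t ∈ J := by
    intro t ht
    simp only [hT, Finset.mem_insert, Finset.mem_image] at ht
    rcases ht with rfl | rfl | ⟨x, -, rfl⟩
    exacts [hp, hq, ha x]
  set m := T.min' hne
  set M := T.max' hne
  have hmM : m < M :=
    (T.min'_le p (by simp [hT])).trans_lt (hpq.trans_le (T.le_max' q (by simp [hT])))
  have hsub : Set.Icc m M ⊆ J := hJ.out (hTJ _ (T.min'_mem hne)) (hTJ _ (T.max'_mem hne))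
  refine ⟨f '' Set.Icc m M, ?_, ?_⟩
  · have hcont : Continuous ((Set.Icc m M).domRestrict f) :=
      continuousOn_iff_continuous_domRestrict.1 (hc.mono hsub)
    have hemb : IsClosedEmbedding ((Set.Icc m M).domRestrict f) :=
      hcont.isClosedEmbedding (Set.injOn_iff_injective.1 (hi.mono hsub))
    have e1 := hemb.isEmbedding.toHomeomorph
    rw [Set.range_domRestrict] at e1
    exact ⟨e1.symm.trans (iccHomeoI m M hmM)⟩
  · intro x hx
    have hx' : a x ∈ T := by
      simp only [hT, Finset.mem_insert, Finset.mem_image]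
      exact Or.inr (Or.inr ⟨x, hx, rfl⟩)
    exact ⟨a x, ⟨T.min'_le _ hx', T.le_max' _ hx'⟩, ha' x⟩

theorem NArcConn.of_homeomorph {X Y : Type*} [TopologicalSpace X] [TopologicalSpace Y] {n : ℕ}
    (h : NArcConn Y n) (e : X ≃ₜ Y) : NArcConn X n := by
  classical
  intro S hS
  obtain ⟨A, ⟨hA⟩, hSA⟩ := h (S.image e) (Finset.card_image_le.trans hS)
  refine ⟨e ⁻¹' A, ⟨(e.sets (s := e ⁻¹' A) rfl).trans hA⟩, fun x hx => hSA ?_⟩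
  simpa using hx

/-- A piecewise linear order automorphism of `ℝ` with prescribed values at `0, 1, 2, 3`. -/
theorem exists_orderIso_real {a b c d : ℝ} (hab : a < b) (hbc : b < c) (hcd : c < d) :
    ∃ e : ℝ ≃o ℝ, e 0 = a ∧ e 1 = b ∧ e 2 = c ∧ e 3 = d := by
  set F : ℝ → ℝ := fun x => a + (b - a) * min x 1 + (c - b) * min (max (x - 1) 0) 1 +
    (d - c) * max (x - 2) 0 with hF
  have hF1 : ∀ x ≤ 1, F x = a + (b - a) * x := fun x hx => by
    simp only [hF]
    rw [min_eq_left hx, max_eq_right (by linarith : x - 1 ≤ 0),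
      max_eq_right (by linarith : x - 2 ≤ 0)]
    simp
  have hF2 : ∀ x, 1 ≤ x → x ≤ 2 → F x = b + (c - b) * (x - 1) := fun x hx hx' => by
    simp only [hF]
    rw [min_eq_right hx, max_eq_left (by linarith : 0 ≤ x - 1), min_eq_left (by linarith),
      max_eq_right (by linarith : x - 2 ≤ 0)]
    ring
  have hF3 : ∀ x, 2 ≤ x → F x = c + (d - c) * (x - 2) := fun x hx => by
    simp only [hF]
    rw [min_eq_right (by linarith), max_eq_left (by linarith : 0 ≤ x - 1),
      min_eq_right (by linarith), max_eq_left (by linarith : 0 ≤ x - 2)]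
    ring
  have hmono : StrictMono F := by
    intro x y hxy
    rcases le_total x 1 with hx | hx
    · have h1 : (b - a) * min x 1 ≤ (b - a) * min y 1 :=
        mul_le_mul_of_nonneg_left (min_le_min_right _ hxy.le) (by linarith)
      rcases le_total y 1 with hy | hy
      · rw [hF1 x hx, hF1 y hy]; nlinarith
      · rw [hF1 x hx]
        rcases le_total y 2 with hy' | hy'
        · rw [hF2 y hy hy']
          rcases hx.lt_or_eq with hx | rfl
          · nlinarith [mul_nonneg (sub_nonneg.2 hbc.le) (sub_nonneg.2 hy)]
          · nlinarith
        · rw [hF3 y hy']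
          nlinarith [mul_nonneg (sub_nonneg.2 hcd.le) (sub_nonneg.2 hy')]
    · rcases le_total y 2 with hy | hy
      · rw [hF2 x hx (by linarith), hF2 y (by linarith) hy]; nlinarith
      · rw [hF3 y hy]
        rcases le_total x 2 with hx' | hx'
        · rw [hF2 x hx hx']
          rcases hx'.lt_or_eq with hx' | rfl
          · nlinarith [mul_nonneg (sub_nonneg.2 hcd.le) (sub_nonneg.2 hy)]
          · nlinarith
        · rw [hF3 x hx']; nlinarith
  have hsurj : Function.Surjective F := by
    intro y
    rcases le_total y b with h1 | h1
    · refine ⟨(y - a) / (b - a), ?_⟩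
      rw [hF1 _ ((div_le_one (by linarith)).2 (by linarith))]
      field_simp [(sub_pos.2 hab).ne']
      ring
    · rcases le_total y c with h2 | h2
      · refine ⟨(y - b) / (c - b) + 1, ?_⟩
        have h3 : 0 ≤ (y - b) / (c - b) := div_nonneg (by linarith) (by linarith)
        have h4 : (y - b) / (c - b) ≤ 1 := (div_le_one (by linarith)).2 (by linarith)
        rw [hF2 _ (by linarith) (by linarith)]
        field_simp [(sub_pos.2 hbc).ne']
        ring
      · refine ⟨(y - c) / (d - c) + 2, ?_⟩
        have h3 : 0 ≤ (y - c) / (d - c) := div_nonneg (by linarith) (by linarith)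
        rw [hF3 _ (by linarith)]
        field_simp [(sub_pos.2 hcd).ne']
        ring
  refine ⟨hmono.orderIsoOfSurjective F hsurj, ?_, ?_, ?_, ?_⟩ <;>
    rw [StrictMono.coe_orderIsoOfSurjective]
  · rw [hF1 _ (by norm_num)]; ring
  · rw [hF1 _ le_rfl]; ring
  · rw [hF3 _ le_rfl]; ring
  · rw [hF3 _ (by norm_num)]; ring

theorem eq_or_mem_of_cos_sin_eq {s t : ℝ} (hs : s ∈ Set.Icc (0 : ℝ) 1)
    (ht : t ∈ Set.Icc (0 : ℝ) 1)
    (hc : Real.cos (2 * Real.pi * s) = Real.cos (2 * Real.pi * t))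
    (hn : Real.sin (2 * Real.pi * s) = Real.sin (2 * Real.pi * t)) :
    s = t ∨ ((s = 0 ∨ s = 1) ∧ (t = 0 ∨ t = 1)) := by
  obtain ⟨k, hk⟩ := Real.Angle.angle_eq_iff_two_pi_dvd_sub.1 (Real.Angle.cos_sin_inj hc hn)
  have hpi := Real.pi_pos
  have h1 : s - t = k := by
    have : 2 * Real.pi * (s - t) = 2 * Real.pi * k := by linarith
    exact mul_left_cancel₀ (by positivity) this
  have h2 : (-2 : ℤ) < k := by
    have : ((-2 : ℤ) : ℝ) < k := by push_cast; linarith [hs.1, ht.2]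
    exact_mod_cast this
  have h3 : k < 2 := by
    have : (k : ℝ) < ((2 : ℤ) : ℝ) := by push_cast; linarith [hs.2, ht.1]
    exact_mod_cast this
  interval_cases k
  · right; norm_num at h1
    exact ⟨Or.inl (by linarith [hs.1, ht.2]), Or.inr (by linarith [hs.1, ht.2])⟩
  · left; norm_num at h1; linarith
  · right; norm_num at h1
    exact ⟨Or.inr (by linarith [hs.2, ht.1]), Or.inl (by linarith [hs.2, ht.1])⟩

theorem cos_two_pi_mul_eq_one_iff {s : ℝ} (hs : s ∈ Set.Icc (0 : ℝ) 1) :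
    Real.cos (2 * Real.pi * s) = 1 ↔ s = 0 ∨ s = 1 := by
  constructor
  · intro h
    have h0 : Real.sin (2 * Real.pi * s) = 0 := by
      have := Real.sin_sq_add_cos_sq (2 * Real.pi * s)
      rw [h] at this
      exact pow_eq_zero_iff (two_ne_zero) |>.1 (by linarith)
    rcases eq_or_mem_of_cos_sin_eq hs (t := 0) (by simp) (by simp [h]) (by simp [h0]) with h | h
    · exact Or.inl h
    · exact h.1
  · rintro (rfl | rfl) <;> simp

theorem exists_cos_sin_two_pi_mul {x y : ℝ} (h : x ^ 2 + y ^ 2 = 1) :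
    ∃ s ∈ Set.Icc (0 : ℝ) 1, Real.cos (2 * Real.pi * s) = x ∧ Real.sin (2 * Real.pi * s) = y := by
  set z : ℂ := ⟨x, y⟩
  have hz : ‖z‖ = 1 := by
    rw [Complex.norm_eq_sqrt_sq_add_sq, h, Real.sqrt_one]
  have hz0 : z ≠ 0 := by
    intro h0; rw [h0] at hz; simp at hz
  have hcos : Real.cos z.arg = x := by rw [Complex.cos_arg hz0, hz]; simp [z]
  have hsin : Real.sin z.arg = y := by rw [Complex.sin_arg, hz]; simp [z]
  set u := z.arg / (2 * Real.pi)
  have hu : z.arg = 2 * Real.pi * u := by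
    simp only [u]; field_simp [Real.pi_ne_zero]
  have hfr : 2 * Real.pi * Int.fract u = z.arg - ⌊u⌋ * (2 * Real.pi) := by
    rw [hu, Int.fract]; ring
  refine ⟨Int.fract u, ⟨Int.fract_nonneg _, (Int.fract_lt_one _).le⟩, ?_, ?_⟩
  · rw [hfr, Real.cos_sub_int_mul_two_pi, hcos]
  · rw [hfr, Real.sin_sub_int_mul_two_pi, hsin]

/-- A planar parametrization of a set `R`, as a traversal of the subspace `R`. -/
theorem IsTraversal.of_plane {R : Set (ℝ × ℝ)} {J : Set ℝ} {g : ℝ → ℝ × ℝ} (hJ : J.Nonempty)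
    (hc : ContinuousOn g J) (hm : ∀ s ∈ J, g s ∈ R) (hs : ∀ p ∈ R, ∃ s ∈ J, g s = p)
    (hb : ∀ p ∈ R, ∃ U ∈ 𝓝 p, ∃ N : ℝ, ∀ s ∈ J, g s ∈ U → |s| ≤ N) :
    ∃ f : ℝ → R, IsTraversal J f ∧ ∀ s ∈ J, ∀ t ∈ J, f s = f t ↔ g s = g t := by
  classical
  obtain ⟨s₀, hs₀⟩ := hJ
  let f : ℝ → R := fun s => if h : s ∈ J then ⟨g s, hm s h⟩ else ⟨g s₀, hm s₀ hs₀⟩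
  have hf : ∀ s ∈ J, (f s : ℝ × ℝ) = g s := fun s h => by simp only [f, dif_pos h]
  refine ⟨f, ⟨?_, ?_, ?_⟩, fun s h t h' => ?_⟩
  · rw [continuousOn_iff_continuous_domRestrict, continuous_induced_rng]
    exact (continuousOn_iff_continuous_domRestrict.1 hc).congr fun s => (hf s s.2).symm
  · rintro ⟨p, hp⟩
    obtain ⟨s, h, rfl⟩ := hs p hp
    exact ⟨s, h, Subtype.ext (hf s h)⟩
  · rintro ⟨p, hp⟩
    obtain ⟨U, hU, N, hN⟩ := hb p hp
    refine ⟨Subtype.val ⁻¹' U, continuous_subtype_val.continuousAt.preimage_mem_nhds hU, N,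
      fun s h h' => hN s h ?_⟩
    rwa [Set.mem_preimage, hf s h] at h'
  · rw [← hf s h, ← hf t h', Subtype.ext_iff]

theorem bounded_of_Icc {a b : ℝ} {g : ℝ → ℝ × ℝ} (p : ℝ × ℝ) :
    ∃ U ∈ 𝓝 p, ∃ N : ℝ, ∀ s ∈ Set.Icc a b, g s ∈ U → |s| ≤ N :=
  ⟨Set.univ, Filter.univ_mem, max |a| |b|, fun _ hs _ => abs_le_max_abs_abs hs.1 hs.2⟩

theorem exists_isTraversal_lollipop : ∃ f : ℝ → lollipopSet, IsTraversal (Set.Icc 0 2) f ∧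
    ∀ s ∈ Set.Icc (0 : ℝ) 2, ∀ t ∈ Set.Icc (0 : ℝ) 2,
      f s = f t ↔ s = t ∨ ((s = 0 ∨ s = 1) ∧ (t = 0 ∨ t = 1)) := by
  let g : ℝ → ℝ × ℝ := fun s =>
    if s ≤ 1 then (Real.cos (2 * Real.pi * s), Real.sin (2 * Real.pi * s)) else (s, 0)
  have hg1 : ∀ s ≤ 1, g s = (Real.cos (2 * Real.pi * s), Real.sin (2 * Real.pi * s)) :=
    fun s hs => if_pos hs
  have hg2 : ∀ s, 1 < s → g s = (s, 0) := fun s hs => if_neg hs.not_ge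
  have hc : Continuous g := by
    refine Continuous.if_le (by fun_prop) (by fun_prop) continuous_id continuous_const ?_
    rintro s rfl; simp
  have key := IsTraversal.of_plane (R := lollipopSet) (g := g) (J := Set.Icc 0 2) ⟨0, by simp⟩
    hc.continuousOn ?_ ?_ (fun p _ => bounded_of_Icc p)
  · obtain ⟨f, hf, hf'⟩ := key
    refine ⟨f, hf, fun s hs t ht => (hf' s hs t ht).trans ?_⟩
    rcases le_or_gt s 1 with h | h <;> rcases le_or_gt t 1 with h' | h'
    · rw [hg1 s h, hg1 t h', Prod.mk.injEq]
      constructor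
      · rintro ⟨h1, h2⟩
        exact eq_or_mem_of_cos_sin_eq ⟨hs.1, h⟩ ⟨ht.1, h'⟩ h1 h2
      · rintro (rfl | ⟨rfl | rfl, rfl | rfl⟩) <;> simp
    · rw [hg1 s h, hg2 t h', Prod.mk.injEq]
      have := Real.cos_le_one (2 * Real.pi * s)
      constructor
      · rintro ⟨h1, -⟩; linarith
      · rintro (h1 | ⟨h1, h2 | h2⟩) <;> linarith
    · rw [hg2 s h, hg1 t h', Prod.mk.injEq]
      have := Real.cos_le_one (2 * Real.pi * t)
      constructor
      · rintro ⟨h1, -⟩; linarith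
      · rintro (h1 | ⟨h1 | h1, h2⟩) <;> linarith
    · rw [hg2 s h, hg2 t h', Prod.mk.injEq]
      constructor
      · rintro ⟨h1, -⟩; exact Or.inl h1
      · rintro (rfl | ⟨h1 | h1, h2⟩)
        · simp
        all_goals linarith
  · intro s hs
    rcases le_or_gt s 1 with h | h
    · rw [hg1 s h]; left; simp [circleAt]
    · rw [hg2 s h]; right; exact ⟨rfl, h.le, hs.2⟩
  · rintro ⟨x, y⟩ (hp | ⟨h0, h1, h2⟩)
    · simp only [circleAt, Set.mem_ofPred_eq, sub_zero, one_pow] at hp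
      obtain ⟨s, hs, rfl, rfl⟩ := exists_cos_sin_two_pi_mul hp
      exact ⟨s, ⟨hs.1, by linarith [hs.2]⟩, hg1 s hs.2⟩
    · simp only at h0 h1 h2
      subst h0
      rcases h1.eq_or_lt with rfl | h1
      · exact ⟨1, by norm_num, by rw [hg1 1 le_rfl]; simp⟩
      · exact ⟨x, ⟨by linarith, h2⟩, hg2 x h1⟩

theorem exists_isTraversal_openLollipop : ∃ f : ℝ → openLollipopSet, IsTraversal (Set.Ici 0) f ∧
    ∀ s ∈ Set.Ici (0 : ℝ), ∀ t ∈ Set.Ici (0 : ℝ),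
      f s = f t ↔ s = t ∨ ((s = 0 ∨ s = 1) ∧ (t = 0 ∨ t = 1)) := by
  let g : ℝ → ℝ × ℝ := fun s =>
    if s ≤ 1 then (Real.cos (2 * Real.pi * s), Real.sin (2 * Real.pi * s))
    else (2 - (max s 1)⁻¹, 0)
  have hg1 : ∀ s ≤ 1, g s = (Real.cos (2 * Real.pi * s), Real.sin (2 * Real.pi * s)) :=
    fun s hs => if_pos hs
  have hg2 : ∀ s, 1 < s → g s = (2 - s⁻¹, 0) := fun s hs => by
    simp only [g, if_neg hs.not_ge, max_eq_left hs.le]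
  have hc : Continuous g := by
    refine Continuous.if_le (by fun_prop) ?_ continuous_id continuous_const ?_
    · refine Continuous.prodMk (continuous_const.sub (Continuous.inv₀ (by fun_prop) ?_))
        continuous_const
      intro x
      have := le_max_right x 1
      linarith
    rintro s rfl; norm_num
  have hlt : ∀ s : ℝ, 1 < s → s⁻¹ < 1 := fun s hs => inv_lt_one_of_one_lt₀ hs
  have hpos : ∀ s : ℝ, 1 < s → 0 < s⁻¹ := fun s hs => inv_pos.2 (by linarith)
  have key := IsTraversal.of_plane (R := openLollipopSet) (g := g) (J := Set.Ici 0) ⟨0, by simp⟩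
    hc.continuousOn ?_ ?_ ?_
  · obtain ⟨f, hf, hf'⟩ := key
    refine ⟨f, hf, fun s hs t ht => (hf' s hs t ht).trans ?_⟩
    rcases le_or_gt s 1 with h | h <;> rcases le_or_gt t 1 with h' | h'
    · rw [hg1 s h, hg1 t h', Prod.mk.injEq]
      constructor
      · rintro ⟨h1, h2⟩
        exact eq_or_mem_of_cos_sin_eq ⟨hs, h⟩ ⟨ht, h'⟩ h1 h2
      · rintro (rfl | ⟨rfl | rfl, rfl | rfl⟩) <;> simp
    · rw [hg1 s h, hg2 t h', Prod.mk.injEq]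
      have := Real.cos_le_one (2 * Real.pi * s)
      have := hlt t h'
      constructor
      · rintro ⟨h1, -⟩; linarith
      · rintro (h1 | ⟨h1, h2 | h2⟩) <;> linarith
    · rw [hg2 s h, hg1 t h', Prod.mk.injEq]
      have := Real.cos_le_one (2 * Real.pi * t)
      have := hlt s h
      constructor
      · rintro ⟨h1, -⟩; linarith
      · rintro (h1 | ⟨h1 | h1, h2⟩) <;> linarith
    · rw [hg2 s h, hg2 t h', Prod.mk.injEq]
      constructor
      · rintro ⟨h1, -⟩; exact Or.inl (inv_injective (by linarith))
      · rintro (rfl | ⟨h1 | h1, h2⟩)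
        · simp
        all_goals linarith
  · intro s hs
    rcases le_or_gt s 1 with h | h
    · rw [hg1 s h]
      refine ⟨Or.inl (by simp [circleAt]), fun h0 => ?_⟩
      have h1 := congrArg Prod.fst (Set.mem_singleton_iff.1 h0)
      have := Real.cos_le_one (2 * Real.pi * s)
      simp only at h1
      linarith
    · rw [hg2 s h]
      have h1 := hlt s h
      have h2 := hpos s h
      refine ⟨Or.inr ⟨rfl, ?_, ?_⟩, fun h0 => ?_⟩
      · simp only; linarith
      · simp only; linarith
      · have h1 := congrArg Prod.fst (Set.mem_singleton_iff.1 h0)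
        simp only at h1
        linarith
  · rintro ⟨x, y⟩ ⟨hp | ⟨h0, h1, h2⟩, hne⟩
    · simp only [circleAt, Set.mem_ofPred_eq, sub_zero, one_pow] at hp
      obtain ⟨s, hs, rfl, rfl⟩ := exists_cos_sin_two_pi_mul hp
      exact ⟨s, hs.1, hg1 s hs.2⟩
    · simp only at h0 h1 h2
      subst h0
      rcases h1.eq_or_lt with rfl | h1
      · exact ⟨1, by norm_num, by rw [hg1 1 le_rfl]; simp⟩
      · have hx : x < 2 := lt_of_le_of_ne h2 (by rintro rfl; exact hne rfl)
        have h3 : 1 < (2 - x)⁻¹ := (one_lt_inv₀ (by linarith)).2 (by linarith)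
        refine ⟨(2 - x)⁻¹, by rw [Set.mem_Ici]; linarith, ?_⟩
        rw [hg2 _ h3, inv_inv, sub_sub_cancel]
  · rintro ⟨x, y⟩ ⟨hp, hne⟩
    have hx : x < 2 := by
      rcases hp with hp | ⟨h0, h1, h2⟩
      · simp only [circleAt, Set.mem_ofPred_eq, sub_zero, one_pow] at hp
        nlinarith [sq_nonneg y]
      · simp only at h0 h1 h2
        subst h0
        exact lt_of_le_of_ne h2 (by rintro rfl; exact hne rfl)
    obtain ⟨r, hr, hr2⟩ := exists_between hx
    refine ⟨{p | p.1 < r}, (isOpen_lt continuous_fst continuous_const).mem_nhds hr,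
      max 1 (2 - r)⁻¹, fun s hs hsU => ?_⟩
    rw [abs_of_nonneg hs]
    rcases le_or_gt s 1 with h | h
    · exact h.trans (le_max_left _ _)
    · rw [hg2 s h] at hsU
      simp only [Set.mem_ofPred_eq] at hsU
      refine le_max_of_le_right ?_
      rw [← inv_inv s]
      exact inv_anti₀ (by linarith) (by linarith)

theorem exists_isTraversal_dumbbell : ∃ f : ℝ → dumbbellSet, IsTraversal (Set.Icc 0 3) f ∧
    ∀ s ∈ Set.Icc (0 : ℝ) 3, ∀ t ∈ Set.Icc (0 : ℝ) 3, f s = f t ↔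
      s = t ∨ ((s = 0 ∨ s = 1) ∧ (t = 0 ∨ t = 1)) ∨ ((s = 2 ∨ s = 3) ∧ (t = 2 ∨ t = 3)) := by
  let g : ℝ → ℝ × ℝ := fun s =>
    if s ≤ 1 then (-2 + Real.cos (2 * Real.pi * s), Real.sin (2 * Real.pi * s))
    else if s ≤ 2 then (2 * s - 3, 0)
    else (2 - Real.cos (2 * Real.pi * (s - 2)), Real.sin (2 * Real.pi * (s - 2)))
  have hg1 : ∀ s ≤ 1, g s = (-2 + Real.cos (2 * Real.pi * s), Real.sin (2 * Real.pi * s)) :=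
    fun s hs => if_pos hs
  have hg2 : ∀ s, 1 < s → s ≤ 2 → g s = (2 * s - 3, 0) := fun s hs hs' => by
    simp only [g, if_neg hs.not_ge, if_pos hs']
  have hg3 : ∀ s, 2 < s →
      g s = (2 - Real.cos (2 * Real.pi * (s - 2)), Real.sin (2 * Real.pi * (s - 2))) :=
    fun s hs => by
      simp only [g, if_neg hs.not_ge, if_neg (show ¬ s ≤ 1 by linarith)]
  have hc : Continuous g := by
    refine Continuous.if_le (by fun_prop) (Continuous.if_le (by fun_prop) (by fun_prop)
      continuous_id continuous_const ?_) continuous_id continuous_const ?_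
    · rintro s rfl; norm_num
    · rintro s rfl; norm_num
  have key := IsTraversal.of_plane (R := dumbbellSet) (g := g) (J := Set.Icc 0 3) ⟨0, by simp⟩
    hc.continuousOn ?_ ?_ (fun p _ => bounded_of_Icc p)
  · obtain ⟨f, hf, hf'⟩ := key
    refine ⟨f, hf, ?_⟩
    have main : ∀ s ∈ Set.Icc (0 : ℝ) 3, ∀ t ∈ Set.Icc (0 : ℝ) 3, s ≤ t → (g s = g t ↔
      s = t ∨ ((s = 0 ∨ s = 1) ∧ (t = 0 ∨ t = 1)) ∨
        ((s = 2 ∨ s = 3) ∧ (t = 2 ∨ t = 3))) := by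
      intro s hs t ht hst
      rcases le_or_gt s 1 with h | h
      · have := Real.cos_le_one (2 * Real.pi * s)
        rcases le_or_gt t 1 with h' | h'
        · rw [hg1 s h, hg1 t h', Prod.mk.injEq]
          constructor
          · rintro ⟨h1, h2⟩
            rcases eq_or_mem_of_cos_sin_eq ⟨hs.1, h⟩ ⟨ht.1, h'⟩ (by linarith) h2 with h3 | h3
            · exact Or.inl h3
            · exact Or.inr (Or.inl h3)
          · rintro (rfl | ⟨rfl | rfl, rfl | rfl⟩ | ⟨h1 | h1, h2⟩) <;>
              first | (exfalso; linarith) | simp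
        · refine iff_of_false (fun h0 => ?_) ?_
          · have h1 := congrArg Prod.fst h0
            rw [hg1 s h] at h1
            rcases le_or_gt t 2 with h2 | h2
            · rw [hg2 t h' h2] at h1; simp only at h1; linarith
            · rw [hg3 t h2] at h1
              have := Real.cos_le_one (2 * Real.pi * (t - 2))
              simp only at h1; linarith
          · rintro (h1 | ⟨h1, h2 | h2⟩ | ⟨h1 | h1, h2⟩) <;> linarith
      · rcases le_or_gt s 2 with hs2 | hs2
        · rcases le_or_gt t 2 with ht2 | ht2
          · rw [hg2 s h hs2, hg2 t (by linarith) ht2, Prod.mk.injEq]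
            constructor
            · rintro ⟨h1, -⟩; left; linarith
            · rintro (rfl | ⟨h1 | h1, h2⟩ | ⟨h1 | h1, h2 | h2⟩) <;>
                first
                | (exfalso; linarith)
                | (simp; done)
                | (norm_num; done)
                | (constructor <;> linarith)
          · rw [hg2 s h hs2, hg3 t ht2, Prod.mk.injEq]
            have h0 := Real.cos_le_one (2 * Real.pi * (t - 2))
            have h3 := cos_two_pi_mul_eq_one_iff (s := t - 2) ⟨by linarith, by linarith [ht.2]⟩
            constructor
            · rintro ⟨h1, -⟩
              right; right
              refine ⟨Or.inl (by linarith), Or.inr ?_⟩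
              rcases h3.1 (by linarith) with h4 | h4 <;> linarith
            · rintro (h1 | ⟨h1 | h1, h2⟩ | ⟨rfl | h1, h2 | rfl⟩) <;>
                first | (exfalso; linarith) | norm_num
        · rw [hg3 s hs2, hg3 t (by linarith), Prod.mk.injEq]
          constructor
          · rintro ⟨h1, h2⟩
            rcases eq_or_mem_of_cos_sin_eq (s := s - 2) (t := t - 2)
              ⟨by linarith, by linarith [hs.2]⟩ ⟨by linarith, by linarith [ht.2]⟩
              (by linarith) h2 with h3 | ⟨h3, h4⟩
            · left; linarith
            · right; right
              exact ⟨h3.imp (fun _ => by linarith) (fun _ => by linarith),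
                h4.imp (fun _ => by linarith) (fun _ => by linarith)⟩
          · rintro (rfl | ⟨h1 | h1, h2⟩ | ⟨rfl | rfl, rfl | rfl⟩) <;>
              first | (exfalso; linarith) | simp
    intro s hs t ht
    rw [hf' s hs t ht]
    rcases le_total s t with h | h
    · exact main s hs t ht h
    · rw [eq_comm, main t ht s hs h, eq_comm, and_comm, and_comm (a := t = 2 ∨ t = 3)]
  · intro s hs
    rcases le_or_gt s 1 with h | h
    · rw [hg1 s h]; left; left; simp [circleAt]
    · rcases le_or_gt s 2 with h2 | h2
      · rw [hg2 s h h2]; right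
        refine ⟨rfl, ?_, ?_⟩ <;> simp only <;> linarith
      · rw [hg3 s h2]; left; right; simp [circleAt]
  · rintro ⟨x, y⟩ ((hp | hp) | ⟨h0, h1, h2⟩)
    · simp only [circleAt, Set.mem_ofPred_eq, sub_zero, one_pow] at hp
      obtain ⟨s, hs, h1, rfl⟩ := exists_cos_sin_two_pi_mul hp
      exact ⟨s, ⟨hs.1, by linarith [hs.2]⟩, by rw [hg1 s hs.2, h1]; simp⟩
    · simp only [circleAt, Set.mem_ofPred_eq, sub_zero, one_pow] at hp
      obtain ⟨s, hs, h1, rfl⟩ := exists_cos_sin_two_pi_mul (x := 2 - x) (y := y) (by linarith)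
      rcases hs.1.eq_or_lt with rfl | h0
      · refine ⟨2, by norm_num, ?_⟩
        rw [hg2 2 (by norm_num) le_rfl]
        norm_num at h1 ⊢
        linarith
      · refine ⟨s + 2, ⟨by linarith, by linarith [hs.2]⟩, ?_⟩
        rw [hg3 _ (by linarith), add_sub_cancel_right, h1]
        simp
    · simp only at h0 h1 h2
      subst h0
      rcases h1.eq_or_lt with rfl | h1
      · exact ⟨1, by norm_num, by rw [hg1 1 le_rfl]; norm_num⟩
      · refine ⟨(x + 3) / 2, ⟨by linarith, by linarith⟩, ?_⟩
        rw [hg2 _ (by linarith) (by linarith)]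
        simp only [Prod.mk.injEq, and_true]
        ring

theorem exists_isTraversal_figureEight : ∃ f : ℝ → figureEightSet,
    IsTraversal (Set.Icc 0 2) f ∧
    ∀ s ∈ Set.Icc (0 : ℝ) 2, ∀ t ∈ Set.Icc (0 : ℝ) 2, f s = f t ↔
      s = t ∨ ((s = 0 ∨ s = 1 ∨ s = 2) ∧ (t = 0 ∨ t = 1 ∨ t = 2)) := by
  let g : ℝ → ℝ × ℝ := fun s =>
    if s ≤ 1 then (-1 + Real.cos (2 * Real.pi * s), Real.sin (2 * Real.pi * s))
    else (1 - Real.cos (2 * Real.pi * (s - 1)), Real.sin (2 * Real.pi * (s - 1)))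
  have hg1 : ∀ s ≤ 1, g s = (-1 + Real.cos (2 * Real.pi * s), Real.sin (2 * Real.pi * s)) :=
    fun s hs => if_pos hs
  have hg2 : ∀ s, 1 < s →
      g s = (1 - Real.cos (2 * Real.pi * (s - 1)), Real.sin (2 * Real.pi * (s - 1))) :=
    fun s hs => if_neg hs.not_ge
  have hc : Continuous g := by
    refine Continuous.if_le (by fun_prop) (by fun_prop) continuous_id continuous_const ?_
    rintro s rfl; norm_num
  have key := IsTraversal.of_plane (R := figureEightSet) (g := g) (J := Set.Icc 0 2)
    ⟨0, by simp⟩ hc.continuousOn ?_ ?_ (fun p _ => bounded_of_Icc p)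
  · obtain ⟨f, hf, hf'⟩ := key
    refine ⟨f, hf, ?_⟩
    have main : ∀ s ∈ Set.Icc (0 : ℝ) 2, ∀ t ∈ Set.Icc (0 : ℝ) 2, s ≤ t → (g s = g t ↔
      s = t ∨ ((s = 0 ∨ s = 1 ∨ s = 2) ∧ (t = 0 ∨ t = 1 ∨ t = 2))) := by
      intro s hs t ht hst
      rcases le_or_gt s 1 with h | h
      · have := Real.cos_le_one (2 * Real.pi * s)
        rcases le_or_gt t 1 with h' | h'
        · rw [hg1 s h, hg1 t h', Prod.mk.injEq]
          constructor
          · rintro ⟨h1, h2⟩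
            rcases eq_or_mem_of_cos_sin_eq ⟨hs.1, h⟩ ⟨ht.1, h'⟩ (by linarith) h2 with h3 | h3
            · exact Or.inl h3
            · exact Or.inr ⟨by tauto, by tauto⟩
          · rintro (rfl | ⟨rfl | rfl | h1, rfl | rfl | h2⟩) <;> first | (exfalso; linarith) | simp
        · rw [hg1 s h, hg2 t h', Prod.mk.injEq]
          have h0 := Real.cos_le_one (2 * Real.pi * (t - 1))
          have h3 := cos_two_pi_mul_eq_one_iff (s := t - 1) ⟨by linarith, by linarith [ht.2]⟩
          have h4 := cos_two_pi_mul_eq_one_iff (s := s) ⟨hs.1, h⟩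
          constructor
          · rintro ⟨h1, -⟩
            right
            refine ⟨?_, ?_⟩
            · rcases h4.1 (by linarith) with h5 | h5 <;> tauto
            · rcases h3.1 (by linarith) with h5 | h5
              · linarith
              · right; right; linarith
          · rintro (h1 | ⟨rfl | rfl | h1, h2 | h2 | rfl⟩) <;>
              first | (exfalso; linarith) | norm_num
      · rw [hg2 s h, hg2 t (by linarith), Prod.mk.injEq]
        constructor
        · rintro ⟨h1, h2⟩
          rcases eq_or_mem_of_cos_sin_eq (s := s - 1) (t := t - 1)
            ⟨by linarith, by linarith [hs.2]⟩ ⟨by linarith, by linarith [ht.2]⟩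
            (by linarith) h2 with h3 | ⟨h3, h4⟩
          · left; linarith
          · right
            exact ⟨Or.inr (h3.imp (fun _ => by linarith) (fun _ => by linarith)),
              Or.inr (h4.imp (fun _ => by linarith) (fun _ => by linarith))⟩
        · rintro (rfl | ⟨h1 | h1 | rfl, h2 | h2 | rfl⟩) <;>
            first | (exfalso; linarith) | simp
    intro s hs t ht
    rw [hf' s hs t ht]
    rcases le_total s t with h | h
    · exact main s hs t ht h
    · rw [eq_comm, main t ht s hs h, eq_comm, and_comm]
  · intro s hs
    rcases le_or_gt s 1 with h | h
    · rw [hg1 s h]; left; simp [circleAt]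
    · rw [hg2 s h]; right; simp [circleAt]
  · rintro ⟨x, y⟩ (hp | hp)
    · simp only [circleAt, Set.mem_ofPred_eq, sub_zero, one_pow] at hp
      obtain ⟨s, hs, h1, rfl⟩ := exists_cos_sin_two_pi_mul hp
      exact ⟨s, ⟨hs.1, by linarith [hs.2]⟩, by rw [hg1 s hs.2, h1]; simp⟩
    · simp only [circleAt, Set.mem_ofPred_eq, sub_zero, one_pow] at hp
      obtain ⟨s, hs, h1, rfl⟩ := exists_cos_sin_two_pi_mul (x := 1 - x) (y := y) (by linarith)
      rcases hs.1.eq_or_lt with rfl | h0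
      · refine ⟨1, by norm_num, ?_⟩
        rw [hg1 1 le_rfl]
        norm_num at h1 ⊢
        linarith
      · refine ⟨s + 1, ⟨by linarith, by linarith [hs.2]⟩, ?_⟩
        rw [hg2 _ (by linarith), add_sub_cancel_right, h1]
        simp

theorem nArcConn_lollipop (n : ℕ) : NArcConn lollipopSet n := by
  obtain ⟨f, hf, hk⟩ := exists_isTraversal_lollipop
  have hsub : Set.Ioc (0 : ℝ) 2 ⊆ Set.Icc 0 2 := Set.Ioc_subset_Icc_self
  refine nArcConn_of_injOn (J := Set.Ioc 0 2) (f := f) (p := 1) (q := 2) Set.ordConnected_Ioc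
    (by norm_num) (by norm_num) (by norm_num) (hf.continuousOn.mono hsub) ?_ ?_ n
  · intro s hs t ht h
    rcases (hk s (hsub hs) t (hsub ht)).1 h with h | ⟨h1, h2⟩
    · exact h
    · rw [h1.resolve_left hs.1.ne', h2.resolve_left ht.1.ne']
  · intro x
    obtain ⟨s, hs, rfl⟩ := hf.surjOn x
    rcases hs.1.eq_or_lt with rfl | h0
    · exact ⟨1, by norm_num, (hk 1 (by norm_num) 0 (by norm_num)).2 (by simp)⟩
    · exact ⟨s, ⟨h0, hs.2⟩, rfl⟩

theorem nArcConn_openLollipop (n : ℕ) : NArcConn openLollipopSet n := by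
  obtain ⟨f, hf, hk⟩ := exists_isTraversal_openLollipop
  have hsub : Set.Ioi (0 : ℝ) ⊆ Set.Ici 0 := Set.Ioi_subset_Ici_self
  refine nArcConn_of_injOn (J := Set.Ioi 0) (f := f) (p := 1) (q := 2) Set.ordConnected_Ioi
    (by norm_num) (by norm_num) (by norm_num) (hf.continuousOn.mono hsub) ?_ ?_ n
  · intro s hs t ht h
    rcases (hk s (hsub hs) t (hsub ht)).1 h with h | ⟨h1, h2⟩
    · exact h
    · rw [h1.resolve_left (ne_of_gt hs), h2.resolve_left (ne_of_gt ht)]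
  · intro x
    obtain ⟨s, hs, rfl⟩ := hf.surjOn x
    rcases (Set.mem_Ici.1 hs).eq_or_lt with rfl | h0
    · exact ⟨1, by norm_num, (hk 1 (by norm_num) 0 (by norm_num)).2 (by simp)⟩
    · exact ⟨s, h0, rfl⟩

theorem nArcConn_dumbbell (n : ℕ) : NArcConn dumbbellSet n := by
  obtain ⟨f, hf, hk⟩ := exists_isTraversal_dumbbell
  have hsub : Set.Ioo (0 : ℝ) 3 ⊆ Set.Icc 0 3 := Set.Ioo_subset_Icc_self
  refine nArcConn_of_injOn (J := Set.Ioo 0 3) (f := f) (p := 1) (q := 2) Set.ordConnected_Ioo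
    (by norm_num) (by norm_num) (by norm_num) (hf.continuousOn.mono hsub) ?_ ?_ n
  · intro s hs t ht h
    rcases (hk s (hsub hs) t (hsub ht)).1 h with h | ⟨h1, h2⟩ | ⟨h1, h2⟩
    · exact h
    · rw [h1.resolve_left hs.1.ne', h2.resolve_left ht.1.ne']
    · rw [h1.resolve_right hs.2.ne, h2.resolve_right ht.2.ne]
  · intro x
    obtain ⟨s, hs, rfl⟩ := hf.surjOn x
    rcases hs.1.eq_or_lt with rfl | h0
    · exact ⟨1, by norm_num, (hk 1 (by norm_num) 0 (by norm_num)).2 (by simp)⟩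
    rcases hs.2.eq_or_lt with rfl | h1
    · exact ⟨2, by norm_num, (hk 2 (by norm_num) 3 (by norm_num)).2 (by simp)⟩
    · exact ⟨s, ⟨h0, h1⟩, rfl⟩

theorem nArcConn_figureEight (n : ℕ) : NArcConn figureEightSet n := by
  obtain ⟨f, hf, hk⟩ := exists_isTraversal_figureEight
  have hsub : Set.Ioo (0 : ℝ) 2 ⊆ Set.Icc 0 2 := Set.Ioo_subset_Icc_self
  refine nArcConn_of_injOn (J := Set.Ioo 0 2) (f := f) (p := 1 / 2) (q := 1) Set.ordConnected_Ioo
    (by norm_num) (by norm_num) (by norm_num) (hf.continuousOn.mono hsub) ?_ ?_ n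
  · intro s hs t ht h
    rcases (hk s (hsub hs) t (hsub ht)).1 h with h | ⟨h1, h2⟩
    · exact h
    · rw [(h1.resolve_left hs.1.ne').resolve_right hs.2.ne,
        (h2.resolve_left ht.1.ne').resolve_right ht.2.ne]
  · intro x
    obtain ⟨s, hs, rfl⟩ := hf.surjOn x
    rcases hs.1.eq_or_lt with rfl | h0
    · exact ⟨1, by norm_num, (hk 1 (by norm_num) 0 (by norm_num)).2 (by simp)⟩
    rcases hs.2.eq_or_lt with rfl | h1
    · exact ⟨1, by norm_num, (hk 1 (by norm_num) 2 (by norm_num)).2 (by simp)⟩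
    · exact ⟨s, ⟨h0, h1⟩, rfl⟩

theorem nArcConn_coe_real {J : Set ℝ} (hJ : J.OrdConnected) {p q : ℝ} (hp : p ∈ J) (hq : q ∈ J)
    (hpq : p < q) (n : ℕ) : NArcConn J n := by
  classical
  refine nArcConn_of_injOn (f := fun s => if h : s ∈ J then (⟨s, h⟩ : J) else ⟨p, hp⟩)
    hJ hp hq hpq ?_ ?_ (fun x => ⟨x, x.2, by simp⟩) n
  · rw [continuousOn_iff_continuous_domRestrict]
    convert (continuous_id : Continuous (id : J → J)) with x
    ext x; simp [Set.domRestrict]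
  · intro s hs t ht h
    simpa [hs, ht] using h

theorem nArcConn_real (n : ℕ) : NArcConn ℝ n :=
  nArcConn_of_injOn (f := id) Set.ordConnected_univ (Set.mem_univ 0) (Set.mem_univ 1) one_pos
    continuousOn_id Function.injective_id.injOn (fun x => ⟨x, trivial, rfl⟩) n

namespace SimpleGraph.Walk

variable {V : Type*} {G : SimpleGraph V}

theorem IsPath.append_of_inter {u v w : V} {p : G.Walk u v} {q : G.Walk v w} (hp : p.IsPath)
    (hq : q.IsPath) (h : ∀ x ∈ p.support, x ∈ q.support → x = v) : (p.append q).IsPath := by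
  rw [isPath_def, support_append, List.nodup_append]
  refine ⟨hp.support_nodup, hq.support_nodup.tail, fun a ha b hb hab => ?_⟩
  subst hab
  have := h a ha (List.mem_of_mem_tail hb)
  subst this
  have h2 := hq.support_nodup
  rw [← cons_tail_support, List.nodup_cons] at h2
  exact h2.1 hb

theorem exists_walk_first_mem (S : Set V) {u v : V} (p : G.Walk u v) (hv : v ∈ S) :
    ∃ z ∈ S, ∃ q : G.Walk u z, q.support ⊆ p.support ∧ ∀ x ∈ q.support, x ∈ S → x = z := by
  induction p with
  | nil => exact ⟨_, hv, .nil, by simp, by simp⟩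
  | @cons a b c hab p ih =>
    by_cases ha : a ∈ S
    · exact ⟨a, ha, .nil, by simp, by simp⟩
    · obtain ⟨z, hz, q, hq, hq'⟩ := ih hv
      refine ⟨z, hz, .cons hab q, ?_, ?_⟩
      · intro x hx
        rw [support_cons, List.mem_cons] at hx ⊢
        exact hx.imp_right (fun h => hq h)
      · intro x hx hxS
        rw [support_cons, List.mem_cons] at hx
        rcases hx with rfl | hx
        · exact absurd hxS ha
        · exact hq' x hx hxS

theorem IsCycle.exists_isPath {x z v : V} {c : G.Walk x x} (hc : c.IsCycle) (hz : z ∈ c.support)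
    (hzx : z ≠ x) (hv : v ∈ c.support) :
    ∃ p : G.Walk x z, p.IsPath ∧ p.support ⊆ c.support ∧ v ∈ p.support := by
  classical
  have hv' := hv
  rw [← take_spec c hz, mem_support_append_iff] at hv'
  rcases hv' with h | h
  · exact ⟨c.takeUntil z hz, hc.isPath_takeUntil hz, c.support_takeUntil_subset_support hz, h⟩
  · refine ⟨(c.dropUntil z hz).reverse, ?_, ?_, by simpa using h⟩
    · rw [← take_spec c hz] at hc
      exact (hc.isPath_of_append_right (not_nil_of_ne hzx.symm)).reverse
    · intro y hy
      rw [support_reverse, List.mem_reverse] at hy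
      exact c.support_dropUntil_subset_support hz hy

end SimpleGraph.Walk

open SimpleGraph in
theorem cyclicallyConnected_of_forall_exists_walk {V : Type*} {G : SimpleGraph V}
    (h : ∀ c x y, x ≠ c → y ≠ c → ∃ p : G.Walk x y, c ∉ p.support)
    (h3 : ∀ x y : V, ∃ z, z ≠ x ∧ z ≠ y) : CyclicallyConnected G := by
  classical
  have key : ∀ x v : V, ∀ p : G.Walk x v, x ≠ v →
      ∃ (u : V) (c : G.Walk u u), c.IsCycle ∧ v ∈ c.support ∧ x ∈ c.support := by
    intro x v p
    induction p with
    | nil => exact fun h => absurd rfl h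
    | @cons y x v hyx p ih =>
      intro hyv
      by_cases hxv : x = v
      · subst hxv
        obtain ⟨t, hty, htx⟩ := h3 y x
        obtain ⟨p1, hp1⟩ := h y x t hyx.ne' hty
        obtain ⟨p2, hp2⟩ := h x t y htx hyx.ne
        have he : s(y, x) ∉ (p1.append p2).bypass.edges := by
          intro hmem
          have := Walk.edges_bypass_subset_edges _ hmem
          rw [Walk.edges_append, List.mem_append] at this
          rcases this with h' | h'
          · exact hp1 (Walk.fst_mem_support_of_mem_edges _ h')
          · exact hp2 (Walk.snd_mem_support_of_mem_edges _ h')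
        refine ⟨y, .cons hyx (p1.append p2).bypass,
          (Walk.cons_isCycle_iff _ _).2 ⟨Walk.bypass_isPath _, he⟩, ?_, ?_⟩ <;> simp
      · obtain ⟨u, c, hc, hv, hx⟩ := ih hxv
        by_cases hy : y ∈ c.support
        · exact ⟨u, c, hc, hv, hy⟩
        obtain ⟨q, hq⟩ := h x y v hyx.ne (Ne.symm hxv)
        obtain ⟨z, hz, r, hr, hr'⟩ := q.exists_walk_first_mem {w | w ∈ c.support} hv
        have hzx : z ≠ x := fun h => hq (h ▸ hr r.end_mem_support)
        obtain ⟨s, hs, hsc, hvs⟩ := (hc.rotate hx).exists_isPath (z := z) (v := v)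
          ((c.mem_support_rotate_iff x hx).2 hz) hzx ((c.mem_support_rotate_iff x hx).2 hv)
        have hsc' : ∀ w ∈ s.support, w ∈ c.support := fun w hw =>
          (c.mem_support_rotate_iff x hx).1 (hsc hw)
        have hpath : (s.append r.bypass.reverse).IsPath := by
          refine hs.append_of_inter (Walk.bypass_isPath _).reverse fun w hw hw' => ?_
          rw [Walk.support_reverse, List.mem_reverse] at hw'
          exact hr' w (Walk.support_bypass_subset_support _ hw') (hsc' w hw)
        refine ⟨y, .cons hyx (s.append r.bypass.reverse),
          (Walk.cons_isCycle_iff _ _).2 ⟨hpath, ?_⟩, ?_, ?_⟩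
        · intro hmem
          rw [Walk.edges_append, List.mem_append] at hmem
          rcases hmem with h' | h'
          · exact hy (hsc' y (Walk.fst_mem_support_of_mem_edges _ h'))
          · have := Walk.snd_mem_support_of_mem_edges _ h'
            rw [Walk.support_reverse, List.mem_reverse] at this
            exact hq (hr (Walk.support_bypass_subset_support _ this))
        · simp [Walk.mem_support_append_iff, hvs]
        · simp
  intro v w
  by_cases hvw : v = w
  · subst hvw
    obtain ⟨w, hw, -⟩ := h3 v v
    obtain ⟨t, ht⟩ := h3 v w
    obtain ⟨p, -⟩ := h t w v ht.2.symm ht.1.symm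
    obtain ⟨u, c, hc, h1, h2⟩ := key _ _ p hw
    exact ⟨u, c, hc, h1, h1⟩
  · obtain ⟨t, ht⟩ := h3 v w
    obtain ⟨p, -⟩ := h t w v ht.2.symm ht.1.symm
    exact key _ _ p (Ne.symm hvw)

theorem exists_separation {V : Type*} {G : SimpleGraph V} (hG : ¬ CyclicallyConnected G)
    (h3 : ∀ x y : V, ∃ z, z ≠ x ∧ z ≠ y) :
    ∃ (c : V) (A : Set V), c ∉ A ∧ A.Nonempty ∧ (∃ b, b ≠ c ∧ b ∉ A) ∧
      ∀ a ∈ A, ∀ b, G.Adj a b → b = c ∨ b ∈ A := by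
  by_contra hno
  refine hG (cyclicallyConnected_of_forall_exists_walk (fun c x y hx hy => ?_) h3)
  by_contra hxy
  refine hno ⟨c, {z | ∃ p : G.Walk x z, c ∉ p.support}, ?_, ⟨x, .nil, by simpa using hx.symm⟩,
    ⟨y, hy, hxy⟩, ?_⟩
  · rintro ⟨p, hp⟩
    exact hp p.end_mem_support
  · rintro a ⟨p, hp⟩ b hab
    refine or_iff_not_imp_left.2 fun hb => ⟨p.concat hab, ?_⟩
    simpa [SimpleGraph.Walk.support_concat, hp] using Ne.symm hb

namespace SimpleGraph

variable {V : Type*}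

/-- `A` is a union of components of `G - c`. -/
structure IsSide (G : SimpleGraph V) (c : V) (A : Set V) : Prop where
  notMem : c ∉ A
  closed : ∀ a ∈ A, ∀ b, G.Adj a b → b = c ∨ b ∈ A

/-- The edges with an endpoint in `A`. -/
def sideEdges (G : SimpleGraph V) (A : Set V) : Set (Sym2 V) :=
  {e | e ∈ G.edgeSet ∧ ∃ x ∈ e, x ∈ A}

/-- Any at most `n` edges of `G` lie on a path extended by an edge at both ends. -/
def PathCover (G : SimpleGraph V) (n : ℕ) : Prop :=
  ∀ l : List (Sym2 V), l.length ≤ n → (∀ e ∈ l, e ∈ G.edgeSet) →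
    ∃ (u v : V) (P : G.Walk u v) (d₁ d₂ : Sym2 V), P.IsPath ∧ u ∈ d₁ ∧ v ∈ d₂ ∧
      ∀ e ∈ l, e ∈ P.edges ∨ e = d₁ ∨ e = d₂

/-- Any at most four edges at the side `A` of `c` lie on a path from `c` extended by an edge. -/
structure RootedCover (G : SimpleGraph V) (c : V) (A : Set V) : Prop extends IsSide G c A where
  cover : ∀ l : List (Sym2 V), l.length ≤ 4 → (∀ e ∈ l, e ∈ G.sideEdges A) →
    ∃ (v : V) (P : G.Walk c v) (d : Sym2 V), P.IsPath ∧ (∀ x ∈ P.support, x = c ∨ x ∈ A) ∧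
      v ∈ d ∧ ∀ e ∈ l, e ∈ P.edges ∨ e = d

variable {G : SimpleGraph V} {c : V} {A : Set V}

theorem mk_mem_sideEdges {x y : V} :
    s(x, y) ∈ G.sideEdges A ↔ G.Adj x y ∧ (x ∈ A ∨ y ∈ A) := by
  simp [sideEdges]

theorem IsSide.compl (h : IsSide G c A) : IsSide G c {b | b ≠ c ∧ b ∉ A} where
  notMem := fun h => h.1 rfl
  closed := by
    rintro a ⟨hac, haA⟩ b hab
    refine or_iff_not_imp_left.2 fun hb => ⟨hb, fun hbA => ?_⟩
    rcases h.closed b hbA a hab.symm with h | h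
    · exact hac h
    · exact haA h

theorem IsSide.mem_of_mem_sideEdges (h : IsSide G c A) {e : Sym2 V} (he : e ∈ G.sideEdges A)
    {x : V} (hx : x ∈ e) : x = c ∨ x ∈ A := by
  obtain ⟨he, y, hy, hyA⟩ := he
  by_cases hxy : x = y
  · exact Or.inr (hxy ▸ hyA)
  · rw [(Sym2.mem_and_mem_iff hxy).1 ⟨hx, hy⟩] at he
    exact h.closed y hyA x (G.mem_edgeSet.1 he).symm

theorem IsSide.support_subset (h : IsSide G c A) {x y : V} (p : G.Walk x y) (hx : x ∈ A)
    (hc : c ∉ p.support) : ∀ z ∈ p.support, z ∈ A := by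
  induction p with
  | nil => simpa using hx
  | @cons a b v hab p ih =>
    rw [Walk.support_cons, List.mem_cons, not_or] at hc
    have hb : b ∈ A := (h.closed a hx b hab).resolve_left
      fun hbc => hc.2 (hbc ▸ p.start_mem_support)
    simpa [hx] using ih hb hc.2

theorem Walk.mem_sideEdges {x y : V} (p : G.Walk x y) (h : ∀ z ∈ p.support, z ∈ A) {e : Sym2 V}
    (he : e ∈ p.edges) : e ∈ G.sideEdges A := by
  refine ⟨p.edges_subset_edgeSet he, ?_⟩
  induction e with
  | h a b => exact ⟨a, by simp, h a (p.fst_mem_support_of_mem_edges he)⟩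

theorem disjoint_sideEdges_compl (h : IsSide G c A) {e : Sym2 V} (he : e ∈ G.sideEdges A)
    (he' : e ∈ G.sideEdges {b | b ≠ c ∧ b ∉ A}) : False := by
  obtain ⟨-, y, hy, h1, h2⟩ := he'
  rcases h.mem_of_mem_sideEdges he hy with h' | h'
  · exact h1 h'
  · exact h2 h'

theorem IsSide.path_one_sided (h : IsSide G c A) {u : V} (Q : G.Walk c u) (hQ : Q.IsPath)
    {d : Sym2 V} (hd : u ∈ d) :
    (∀ e ∈ G.sideEdges A, e ∉ Q.edges ∧ e ≠ d) ∨
    ((∀ e ∈ G.sideEdges {b | b ≠ c ∧ b ∉ A}, e ∉ Q.edges ∧ e ≠ d) ∧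
      ∀ x ∈ Q.support, x = c ∨ x ∈ A) := by
  cases Q with
  | nil =>
    by_cases hdA : d ∈ G.sideEdges A
    · right
      refine ⟨fun e he => ⟨by simp, ?_⟩, by simp⟩
      rintro rfl
      exact disjoint_sideEdges_compl h hdA he
    · left
      refine fun e he => ⟨by simp, ?_⟩
      rintro rfl
      exact hdA he
  | @cons _ x _ hcx q =>
    rw [Walk.cons_isPath_iff] at hQ
    have aux : ∀ {B : Set V}, IsSide G c B → x ∈ B → ∀ e, (e ∈ (Walk.cons hcx q).edges ∨
        (e = d ∧ e ∈ G.edgeSet)) → e ∈ G.sideEdges B := by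
      intro B hB hx e he
      have hs := hB.support_subset q hx hQ.2
      rcases he with he | ⟨rfl, he⟩
      · rw [Walk.edges_cons, List.mem_cons] at he
        rcases he with rfl | he
        · exact mk_mem_sideEdges.2 ⟨hcx, Or.inr hx⟩
        · exact q.mem_sideEdges hs he
      · exact ⟨he, u, hd, hs u q.end_mem_support⟩
    by_cases hx : x ∈ A
    · right
      refine ⟨fun e he => ⟨fun h1 => ?_, fun h1 => ?_⟩, ?_⟩
      · exact disjoint_sideEdges_compl h (aux h hx e (Or.inl h1)) he
      · exact disjoint_sideEdges_compl h (aux h hx e (Or.inr ⟨h1, he.1⟩)) he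
      · intro z hz
        rw [Walk.support_cons, List.mem_cons] at hz
        exact hz.imp_right (h.support_subset q hx hQ.2 z)
    · left
      have hx' : x ∈ {b | b ≠ c ∧ b ∉ A} := ⟨hcx.ne', hx⟩
      refine fun e he => ⟨fun h1 => ?_, fun h1 => ?_⟩
      · exact disjoint_sideEdges_compl h he (aux h.compl hx' e (Or.inl h1))
      · exact disjoint_sideEdges_compl h he (aux h.compl hx' e (Or.inr ⟨h1, he.1⟩))

theorem IsSide.rootedCover (h : IsSide G c A) (hG : G.PathCover 5) {b : Sym2 V}
    (hb : b ∈ G.sideEdges {b | b ≠ c ∧ b ∉ A}) : RootedCover G c A where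
  toIsSide := h
  cover := by
    classical
    intro l hl hlA
    by_cases hnil : l = []
    · exact ⟨c, .nil, s(c, c), by simp, by simp, by simp, by simp [hnil]⟩
    obtain ⟨e₀, he₀⟩ := List.exists_mem_of_ne_nil l hnil
    obtain ⟨u, v, P, d₁, d₂, hP, hu, hv, hcov⟩ := hG (b :: l) (by rw [List.length_cons]; omega)
      (by simpa using ⟨hb.1, fun e he => (hlA e he).1⟩)
    have hcP : c ∈ P.support := by
      by_contra hcP
      have aux : ∀ {B : Set V}, IsSide G c B → u ∈ B → ∀ e ∈ b :: l, e ∈ G.edgeSet →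
          e ∈ G.sideEdges B := by
        intro B hB huB e he heG
        have hs := hB.support_subset P huB hcP
        rcases hcov e he with he | rfl | rfl
        · exact P.mem_sideEdges hs he
        · exact ⟨heG, u, hu, huB⟩
        · exact ⟨heG, v, hv, hs v P.end_mem_support⟩
      by_cases huA : u ∈ A
      · exact disjoint_sideEdges_compl h (aux h huA b (by simp) hb.1) hb
      · refine disjoint_sideEdges_compl h (hlA e₀ he₀) (aux h.compl ⟨?_, huA⟩ e₀ (by simp [he₀])
          (hlA e₀ he₀).1)
        rintro rfl
        exact hcP P.start_mem_support
    have hcov' : ∀ e ∈ b :: l, (e ∈ (P.takeUntil c hcP).reverse.edges ∨ e = d₁) ∨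
        (e ∈ (P.dropUntil c hcP).edges ∨ e = d₂) := by
      intro e he
      have := hcov e he
      rw [← P.take_spec hcP, Walk.edges_append, List.mem_append] at this
      rw [Walk.edges_reverse, List.mem_reverse]
      tauto
    have main : ∀ {u v : V} (P₁ : G.Walk c u) (P₂ : G.Walk c v) (d₁ d₂ : Sym2 V), P₁.IsPath →
        P₂.IsPath → u ∈ d₁ → v ∈ d₂ → (∀ e ∈ b :: l, (e ∈ P₁.edges ∨ e = d₁) ∨
          (e ∈ P₂.edges ∨ e = d₂)) → (b ∈ P₁.edges ∨ b = d₁) →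
        ∃ (v : V) (P : G.Walk c v) (d : Sym2 V), P.IsPath ∧ (∀ x ∈ P.support, x = c ∨ x ∈ A) ∧
          v ∈ d ∧ ∀ e ∈ l, e ∈ P.edges ∨ e = d := by
      intro u v P₁ P₂ d₁ d₂ h₁ h₂ hu hv hcov hb₁
      rcases h.path_one_sided P₁ h₁ hu with hs₁ | hs₁
      · have hcov₂ : ∀ e ∈ l, e ∈ P₂.edges ∨ e = d₂ := fun e he =>
          (hcov e (List.mem_cons_of_mem _ he)).resolve_left fun h' =>
            h'.elim (hs₁ e (hlA e he)).1 (hs₁ e (hlA e he)).2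
        rcases h.path_one_sided P₂ h₂ hv with hs₂ | hs₂
        · exact ((hcov₂ e₀ he₀).elim (hs₂ e₀ (hlA e₀ he₀)).1 (hs₂ e₀ (hlA e₀ he₀)).2).elim
        · exact ⟨v, P₂, d₂, h₂, hs₂.2, hv, hcov₂⟩
      · exact (hb₁.elim (hs₁.1 b hb).1 (hs₁.1 b hb).2).elim
    have h₁ := (hP.takeUntil hcP).reverse
    have h₂ := hP.dropUntil hcP
    rcases hcov' b (by simp) with hb' | hb'
    · exact main _ _ d₁ d₂ h₁ h₂ hu hv hcov' hb'
    · exact main _ _ d₂ d₁ h₂ h₁ hv hu (fun e he => (hcov' e he).symm) hb'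

end SimpleGraph

namespace SimpleGraph

variable {V : Type*} {G : SimpleGraph V} {c : V} {A : Set V}

theorem Walk.edges_eq_of_common_paths {a b : V} (P : G.Walk a b) (hP : P.IsPath)
    {K : Set (Sym2 V)} (hPK : ∀ e ∈ P.edges, e ∈ K)
    (h : ∀ e ∈ K, ∀ e' ∈ K, ∃ Q : G.Walk a b, Q.IsPath ∧ (∀ e ∈ Q.edges, e ∈ K) ∧
      e ∈ Q.edges ∧ e' ∈ Q.edges) : ∀ e ∈ K, e ∈ P.edges := by
  induction P generalizing K with
  | nil =>
    intro e he
    obtain ⟨Q, hQ, -, heQ, -⟩ := h e he e he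
    cases Q with
    | nil => simp at heQ
    | cons hab q =>
      rw [Walk.cons_isPath_iff] at hQ
      exact absurd q.end_mem_support hQ.2
  | @cons a x b hax P ih =>
    rw [Walk.cons_isPath_iff] at hP
    have huniq : ∀ y, s(a, y) ∈ K → y = x := by
      intro y hy
      obtain ⟨Q, hQ, -, h1, h2⟩ := h _ hy s(a, x) (hPK _ (by simp))
      rw [hQ.eq_snd_of_mem_edges h1, hQ.eq_snd_of_mem_edges h2]
    have hK : ∀ e ∈ {e ∈ K | a ∉ e}, e ∈ P.edges := by
      refine ih hP.1 (fun e he => ⟨hPK e (by simp [he]), fun ha => ?_⟩) fun e he e' he' => ?_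
      · obtain ⟨y, rfl⟩ := Sym2.mem_iff_exists.1 ha
        exact hP.2 (P.fst_mem_support_of_mem_edges he)
      · obtain ⟨Q, hQ, hQK, h1, h2⟩ := h e he.1 e' he'.1
        cases Q with
        | nil => simp at h1
        | @cons _ y _ hay Q =>
          obtain rfl := huniq y (hQK _ (by simp))
          rw [Walk.cons_isPath_iff] at hQ
          have aux : ∀ f ∈ (Walk.cons hay Q).edges, a ∉ f → f ∈ Q.edges := by
            intro f hf haf
            rw [Walk.edges_cons, List.mem_cons] at hf
            refine hf.resolve_left ?_
            rintro rfl
            exact haf (by simp)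
          refine ⟨Q, hQ.1, fun f hf => ⟨hQK f (by simp [hf]), fun haf => ?_⟩, aux e h1 he.2,
            aux e' h2 he'.2⟩
          obtain ⟨z, rfl⟩ := Sym2.mem_iff_exists.1 haf
          exact hQ.2 (Q.fst_mem_support_of_mem_edges hf)
    intro e he
    by_cases ha : a ∈ e
    · obtain ⟨y, rfl⟩ := Sym2.mem_iff_exists.1 ha
      simp [huniq y he]
    · simp [hK e ⟨he, ha⟩]

/-- The edges of a sequence of vertices, up to index `m`. -/
def seqEdges (w : ℕ → V) (m : ℕ∞) : Set (Sym2 V) :=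
  {e | ∃ i : ℕ, (i : ℕ∞) < m ∧ e = s(w i, w (i + 1))}

/-- The side `A` of `c` is traversed by the vertex sequence `w`, which is a finite path. -/
structure IsFinSide (G : SimpleGraph V) (c : V) (A : Set V) (w : ℕ → V) (n : ℕ) : Prop where
  zero : w 0 = c
  injOn : Set.InjOn w (Set.Iic n)
  edges : G.sideEdges A = seqEdges w n

/-- The side `A` of `c` is traversed by the vertex sequence `w`, which is a finite path ending in
a cycle. -/
structure IsLoopSide (G : SimpleGraph V) (c : V) (A : Set V) (w : ℕ → V) (k n : ℕ) : Prop where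
  zero : w 0 = c
  le : k + 3 ≤ n
  injOn : Set.InjOn w (Set.Iio n)
  eq : w n = w k
  edges : G.sideEdges A = seqEdges w n

/-- The side `A` of `c` is traversed by the vertex sequence `w`, which is a ray. -/
structure IsRaySide (G : SimpleGraph V) (c : V) (A : Set V) (w : ℕ → V) : Prop where
  zero : w 0 = c
  inj : Function.Injective w
  edges : G.sideEdges A = seqEdges w ⊤

/-- The side `A` of `c` is traversed by a finite vertex sequence. -/
def HasFiniteSpine (G : SimpleGraph V) (c : V) (A : Set V) : Prop :=
  (∃ w n, IsFinSide G c A w n) ∨ ∃ w k n, IsLoopSide G c A w k n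

theorem RootedCover.sideEdges_eq_empty (h : RootedCover G c A) (hn : ∀ y ∈ A, ¬ G.Adj c y) :
    G.sideEdges A = ∅ := by
  rw [Set.eq_empty_iff_forall_notMem]
  rintro e he
  obtain ⟨v, P, d, hP, hs, hv, hcov⟩ := h.cover [e] (by simp) (by simpa using he)
  cases P with
  | nil =>
    obtain rfl : e = d := by simpa using hcov
    obtain ⟨y, rfl⟩ := Sym2.mem_iff_exists.1 hv
    rw [mk_mem_sideEdges] at he
    exact hn y (he.2.resolve_left h.notMem) he.1
  | @cons _ x _ hcx p =>
    exact hn x ((hs x (by simp)).resolve_left hcx.ne') hcx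

theorem IsSide.sideEdges_eq_insert (h : IsSide G c A) {y : V} (hy : y ∈ A) (hcy : G.Adj c y)
    (hu : ∀ z ∈ A, G.Adj c z → z = y) :
    G.sideEdges A = insert s(c, y) (G.sideEdges (A \ {y})) := by
  ext e
  induction e with
  | h p q =>
    rw [Set.mem_insert_iff, mk_mem_sideEdges, mk_mem_sideEdges]
    constructor
    · rintro ⟨hpq, hor⟩
      by_cases hc : c = p ∨ c = q
      · left
        rcases hc with rfl | rfl
        · rw [hu q (hor.resolve_left h.notMem) hpq]
        · rw [hu p (hor.resolve_right h.notMem) hpq.symm, Sym2.eq_swap]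
      · right
        refine ⟨hpq, ?_⟩
        have hpA : p ∈ A := by
          rcases hor with h' | h'
          · exact h'
          · exact (h.closed q h' p hpq.symm).resolve_left (fun h => hc (Or.inl h.symm))
        have hqA : q ∈ A := (h.closed p hpA q hpq).resolve_left (fun h => hc (Or.inr h.symm))
        by_cases hpy : p = y
        · exact Or.inr ⟨hqA, fun hq => hpq.ne (hpy.trans hq.symm)⟩
        · exact Or.inl ⟨hpA, hpy⟩
    · rintro (h' | ⟨hpq, hor⟩)
      · rw [Sym2.eq_iff] at h'
        rcases h' with ⟨rfl, rfl⟩ | ⟨rfl, rfl⟩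
        · exact ⟨hcy, Or.inr hy⟩
        · exact ⟨hcy.symm, Or.inl hy⟩
      · exact ⟨hpq, hor.imp (fun h => h.1) (fun h => h.1)⟩

theorem RootedCover.diff (h : RootedCover G c A) {y : V} (hy : y ∈ A)
    (hu : ∀ z ∈ A, G.Adj c z → z = y) (hcy : G.Adj c y) : RootedCover G y (A \ {y}) where
  notMem := by simp
  closed := by
    rintro a ⟨haA, hay⟩ b hab
    rcases h.closed a haA b hab with rfl | hb
    · exact absurd (hu a haA hab.symm) hay
    · exact or_iff_not_imp_left.2 fun hby => ⟨hb, hby⟩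
  cover := by
    intro l hl hlA
    have hcl : ∀ e ∈ l, c ∉ e := by
      intro e he hce
      obtain ⟨z, rfl⟩ := Sym2.mem_iff_exists.1 hce
      have := mk_mem_sideEdges.1 (hlA _ he)
      have hz := this.2.resolve_left fun hc => h.notMem hc.1
      exact hz.2 (hu z hz.1 this.1)
    obtain ⟨v, P, d, hP, hs, hv, hcov⟩ := h.cover l hl fun e he => by
      rw [h.sideEdges_eq_insert hy hcy hu]; exact Or.inr (hlA e he)
    cases P with
    | nil =>
      refine ⟨y, .nil, s(y, y), by simp, by simp, by simp, fun e he => ?_⟩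
      have hed : e = d := by simpa using hcov e he
      exact absurd (hed ▸ hv) (hcl e he)
    | @cons _ x _ hcx p =>
      rw [Walk.cons_isPath_iff] at hP
      have hxA : x ∈ A := (hs x (by simp)).resolve_left hcx.ne'
      obtain rfl := hu x hxA hcx
      refine ⟨v, p, d, hP.1, fun z hz => ?_, hv, fun e he => ?_⟩
      · exact or_iff_not_imp_left.2 fun hzx =>
          ⟨h.support_subset p hy hP.2 z hz, hzx⟩
      · refine (hcov e he).imp_left fun h' => ?_
        rw [Walk.edges_cons, List.mem_cons] at h'
        refine h'.resolve_left ?_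
        rintro rfl
        exact hcl _ he (by simp)

end SimpleGraph

namespace SimpleGraph

variable {V : Type*} {G : SimpleGraph V} {c : V} {A : Set V}

theorem RootedCover.eq_of_adj (h : RootedCover G c A) {a b z : V} (ha : a ∈ A) (hb : b ∈ A)
    (hab : a ≠ b) (hca : G.Adj c a) (hcb : G.Adj c b) (hz : z ∈ A) (hcz : G.Adj c z) :
    z = a ∨ z = b := by
  obtain ⟨v, P, d, hP, hs, hv, hcov⟩ := h.cover [s(c, a), s(c, b), s(c, z)] (by simp)
    (by simp [mk_mem_sideEdges, *])
  have key : ∀ y, s(c, y) ∈ [s(c, a), s(c, b), s(c, z)] → y = P.snd ∨ s(c, y) = d :=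
    fun y hy => (hcov _ hy).imp_left fun h' => hP.eq_snd_of_mem_edges h'
  have h1 := key a (by simp)
  have h2 := key b (by simp)
  have h3 := key z (by simp)
  have hinj : ∀ x y, s(c, x) = d → s(c, y) = d → x = y :=
    fun x y hx hy => Sym2.congr_right.1 (hx.trans hy.symm)
  have := hinj a b
  have := hinj a z
  have := hinj b z
  grind

theorem RootedCover.exists_path (h : RootedCover G c A) {a b : V} (ha : a ∈ A) (hb : b ∈ A)
    (hab : a ≠ b) (hca : G.Adj c a) (hcb : G.Adj c b) (l : List (Sym2 V)) (hl : l.length ≤ 2)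
    (hlA : ∀ e ∈ l, e ∈ G.sideEdges A ∧ c ∉ e) :
    ∃ Q : G.Walk a b, Q.IsPath ∧ (∀ z ∈ Q.support, z ∈ A) ∧ ∀ e ∈ l, e ∈ Q.edges := by
  obtain ⟨v, P, d, hP, hs, hv, hcov⟩ := h.cover (s(c, a) :: s(c, b) :: l)
    (by simp only [List.length_cons]; omega) (by
      simp only [List.mem_cons, forall_eq_or_imp, mk_mem_sideEdges]
      exact ⟨⟨hca, Or.inr ha⟩, ⟨hcb, Or.inr hb⟩, fun e he => (hlA e he).1⟩)
  simp only [List.mem_cons, forall_eq_or_imp] at hcov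
  obtain ⟨h1, h2, h3⟩ := hcov
  cases P with
  | nil =>
    simp only [Walk.edges_nil, List.not_mem_nil, false_or] at h1 h2
    exact absurd (Sym2.congr_right.1 (h1.trans h2.symm)) hab
  | @cons _ x _ hcx p =>
    replace h1 := h1.imp_left fun h' => hP.eq_snd_of_mem_edges h'
    replace h2 := h2.imp_left fun h' => hP.eq_snd_of_mem_edges h'
    rw [Walk.cons_isPath_iff] at hP
    rw [Walk.snd_cons] at h1 h2
    have hxA : x ∈ A := (hs x (by simp)).resolve_left hcx.ne'
    have hsA := h.support_subset p hxA hP.2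
    have hvc : v ≠ c := fun hvc => hP.2 (hvc ▸ p.end_mem_support)
    have hlp : ∀ e ∈ l, c ∈ d → e ∈ p.edges := by
      intro e he hcd
      rcases h3 e he with h' | rfl
      · rw [Walk.edges_cons, List.mem_cons] at h'
        refine h'.resolve_left ?_
        rintro rfl
        exact (hlA _ he).2 (by simp)
      · exact absurd hcd (hlA _ he).2
    rcases h1 with rfl | rfl
    · have hd := h2.resolve_left hab.symm
      have hvb : v = b := by
        rw [← hd, Sym2.mem_iff] at hv
        exact hv.resolve_left hvc
      subst hvb
      exact ⟨p, hP.1, hsA, fun e he => hlp e he (by simp [← hd])⟩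
    · have hva : v = a := (Sym2.mem_iff.1 hv).resolve_left hvc
      have hbx : b = x := h2.resolve_right fun h' => hab (Sym2.congr_right.1 h').symm
      subst hva hbx
      exact ⟨p.reverse, hP.1.reverse, by simpa using hsA,
        fun e he => by simpa using hlp e he (by simp)⟩

theorem Walk.mem_edges_iff_mem_seqEdges {u v : V} (p : G.Walk u v) {e : Sym2 V} :
    e ∈ p.edges ↔ e ∈ seqEdges p.getVert p.length := by
  induction e with
  | h x y =>
    rw [Walk.mk_mem_edges_iff_exists]
    simp [seqEdges, eq_comm]

theorem RootedCover.isLoopSide (h : RootedCover G c A) {a b : V} (ha : a ∈ A) (hb : b ∈ A)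
    (hab : a ≠ b) (hca : G.Adj c a) (hcb : G.Adj c b) : ∃ w n, IsLoopSide G c A w 0 n := by
  obtain ⟨P, hP, hPA, -⟩ := h.exists_path ha hb hab hca hcb [] (by simp) (by simp)
  have hK : ∀ {Q : G.Walk a b}, (∀ z ∈ Q.support, z ∈ A) → ∀ e ∈ Q.edges,
      e ∈ {e ∈ G.sideEdges A | c ∉ e} := by
    intro Q hQ e he
    refine ⟨Q.mem_sideEdges hQ he, fun hce => ?_⟩
    obtain ⟨z, rfl⟩ := Sym2.mem_iff_exists.1 hce
    exact h.notMem (hQ c (Q.fst_mem_support_of_mem_edges he))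
  have hall := P.edges_eq_of_common_paths hP (K := {e ∈ G.sideEdges A | c ∉ e}) (hK hPA)
    fun e he e' he' => by
      obtain ⟨Q, hQ, hQA, hl⟩ := h.exists_path ha hb hab hca hcb [e, e'] (by simp)
        (by simpa using ⟨he, he'⟩)
      exact ⟨Q, hQ, hK hQA, hl e (by simp), hl e' (by simp)⟩
  have hcP : c ∉ P.support := fun hc => h.notMem (hPA c hc)
  have hC : (Walk.cons hca (P.concat hcb.symm)).IsCycle := by
    rw [Walk.cons_isCycle_iff, Walk.concat_isPath_iff]
    refine ⟨⟨hP, hcP⟩, fun hmem => ?_⟩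
    rw [Walk.edges_concat, List.concat_eq_append, List.mem_append, List.mem_singleton] at hmem
    rcases hmem with hmem | hmem
    · exact hcP (P.fst_mem_support_of_mem_edges hmem)
    · rw [Sym2.eq_swap] at hmem
      exact hab (Sym2.congr_left.1 hmem)
  refine ⟨(Walk.cons hca (P.concat hcb.symm)).getVert, (Walk.cons hca (P.concat hcb.symm)).length,
    Walk.getVert_zero _, ?_, ?_, ?_, ?_⟩
  · simpa using hC.three_le_length
  · refine hC.getVert_injOn'.mono fun i hi => ?_
    have := hC.three_le_length
    simp only [Set.mem_Iio] at hi
    simp only [Set.mem_ofPred_eq]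
    omega
  · rw [Walk.getVert_length, Walk.getVert_zero]
  · ext e
    rw [← Walk.mem_edges_iff_mem_seqEdges, Walk.edges_cons, Walk.edges_concat]
    simp only [List.concat_eq_append, List.mem_cons, List.mem_append, List.not_mem_nil, or_false]
    constructor
    · intro he
      by_cases hc : c ∈ e
      · obtain ⟨z, rfl⟩ := Sym2.mem_iff_exists.1 hc
        rw [mk_mem_sideEdges] at he
        rcases h.eq_of_adj ha hb hab hca hcb (he.2.resolve_left h.notMem) he.1 with rfl | rfl
        · exact Or.inl rfl
        · exact Or.inr (Or.inr Sym2.eq_swap)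
      · exact Or.inr (Or.inl (hall e ⟨he, hc⟩))
    · rintro (rfl | he | rfl)
      · exact mk_mem_sideEdges.2 ⟨hca, Or.inr ha⟩
      · exact P.mem_sideEdges hPA he
      · exact mk_mem_sideEdges.2 ⟨hcb.symm, Or.inl hb⟩

/-- The sequence `w` preceded by `c`. -/
def consSeq (c : V) (w : ℕ → V) : ℕ → V
  | 0 => c
  | i + 1 => w i

theorem seqEdges_consSeq (c : V) (w : ℕ → V) (n : ℕ) :
    seqEdges (consSeq c w) (n + 1 : ℕ) = insert s(c, w 0) (seqEdges w n) := by
  ext e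
  simp only [seqEdges, Set.mem_ofPred_eq, Set.mem_insert_iff, Nat.cast_lt]
  constructor
  · rintro ⟨i, hi, rfl⟩
    cases i with
    | zero => exact Or.inl rfl
    | succ i => exact Or.inr ⟨i, by omega, rfl⟩
  · rintro (rfl | ⟨i, hi, rfl⟩)
    · exact ⟨0, by omega, rfl⟩
    · exact ⟨i + 1, by omega, rfl⟩

theorem IsSide.seq_eq_or_mem (h : IsSide G c A) {w : ℕ → V} {m : ℕ∞}
    (hw0 : w 0 = c) (hE : G.sideEdges A = seqEdges w m) {i : ℕ} (hi : (i : ℕ∞) ≤ m) :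
    w i = c ∨ w i ∈ A := by
  cases i with
  | zero => exact Or.inl hw0
  | succ i =>
    have he : s(w i, w (i + 1)) ∈ G.sideEdges A := by
      rw [hE]
      exact ⟨i, lt_of_lt_of_le (by exact_mod_cast i.lt_succ_self) hi, rfl⟩
    exact h.mem_of_mem_sideEdges he (by simp)

theorem HasFiniteSpine.cons (h : IsSide G c A) {y : V} (hy : y ∈ A) (hcy : G.Adj c y)
    (hu : ∀ z ∈ A, G.Adj c z → z = y) (h' : IsSide G y (A \ {y}))
    (hs : HasFiniteSpine G y (A \ {y})) : HasFiniteSpine G c A := by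
  have hE := h.sideEdges_eq_insert hy hcy hu
  have hne : ∀ {w : ℕ → V} {m : ℕ∞} {i : ℕ}, w 0 = y → G.sideEdges (A \ {y}) = seqEdges w m →
      (i : ℕ∞) ≤ m → w i ≠ c := by
    intro w m i hw0 hwE hi hwc
    rcases h'.seq_eq_or_mem hw0 hwE hi with h1 | h1
    · exact h.notMem (by rwa [← hwc, h1])
    · exact h.notMem (hwc ▸ h1.1)
  rcases hs with ⟨w, n, hw⟩ | ⟨w, k, n, hw⟩
  · refine Or.inl ⟨consSeq c w, n + 1, rfl, ?_, ?_⟩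
    · intro i hi j hj hij
      have hi' : i ≤ n + 1 := hi
      have hj' : j ≤ n + 1 := hj
      cases i <;> cases j
      · rfl
      · exact absurd hij.symm (hne (w := w) (m := n) hw.zero hw.edges (Nat.cast_le.2 (by omega)))
      · exact absurd hij (hne (w := w) (m := n) hw.zero hw.edges (Nat.cast_le.2 (by omega)))
      · rw [hw.injOn (Set.mem_Iic.2 (by omega)) (Set.mem_Iic.2 (by omega)) hij]
    · rw [seqEdges_consSeq, hw.zero, ← hw.edges, hE]
  · refine Or.inr ⟨consSeq c w, k + 1, n + 1, rfl, ?_, ?_, hw.eq, ?_⟩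
    · have := hw.le; omega
    · intro i hi j hj hij
      have hi' : i < n + 1 := hi
      have hj' : j < n + 1 := hj
      cases i <;> cases j
      · rfl
      · exact absurd hij.symm (hne (w := w) (m := n) hw.zero hw.edges (Nat.cast_le.2 (by omega)))
      · exact absurd hij (hne (w := w) (m := n) hw.zero hw.edges (Nat.cast_le.2 (by omega)))
      · rw [hw.injOn (Set.mem_Iio.2 (by omega)) (Set.mem_Iio.2 (by omega)) hij]
    · rw [seqEdges_consSeq, hw.zero, ← hw.edges, hE]

theorem RootedCover.exists_next (h : RootedCover G c A) (hn : ¬ HasFiniteSpine G c A) :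
    ∃ y ∈ A, G.Adj c y ∧ (∀ z ∈ A, G.Adj c z → z = y) ∧ RootedCover G y (A \ {y}) ∧
      ¬ HasFiniteSpine G y (A \ {y}) := by
  by_cases h0 : ∀ y ∈ A, ¬ G.Adj c y
  · refine absurd (Or.inl ⟨fun _ => c, 0, rfl, fun i hi j hj _ => ?_, ?_⟩) hn
    · rw [Nat.le_zero.1 hi, Nat.le_zero.1 hj]
    · rw [h.sideEdges_eq_empty h0]
      ext e
      simp [seqEdges]
  push Not at h0
  obtain ⟨y, hy, hcy⟩ := h0
  have hu : ∀ z ∈ A, G.Adj c z → z = y := by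
    intro z hz hcz
    by_contra hzy
    obtain ⟨w, n, hw⟩ := h.isLoopSide hz hy hzy hcz hcy
    exact hn (Or.inr ⟨w, 0, n, hw⟩)
  have h' := h.diff hy hu hcy
  exact ⟨y, hy, hcy, hu, h', fun hs => hn (hs.cons h.toIsSide hy hcy hu h'.toIsSide)⟩

theorem RootedCover.exists_isRaySide (h : RootedCover G c A) (hn : ¬ HasFiniteSpine G c A) :
    ∃ w, IsRaySide G c A w := by
  choose next hmem hadj huniq hroot hnot using
    fun x : {x : V × Set V // RootedCover G x.1 x.2 ∧ ¬ HasFiniteSpine G x.1 x.2} =>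
      x.2.1.exists_next x.2.2
  let σ : ℕ → {x : V × Set V // RootedCover G x.1 x.2 ∧ ¬ HasFiniteSpine G x.1 x.2} := fun n =>
    Nat.rec ⟨(c, A), h, hn⟩ (fun _ x => ⟨(next x, x.1.2 \ {next x}), hroot x, hnot x⟩) n
  let w : ℕ → V := fun n => (σ n).1.1
  let B : ℕ → Set V := fun n => (σ n).1.2
  have hB : ∀ n, B (n + 1) = B n \ {w (n + 1)} := fun n => rfl
  have hwB : ∀ n, w (n + 1) ∈ B n := fun n => hmem (σ n)
  have hside : ∀ n, IsSide G (w n) (B n) := fun n => (σ n).2.1.toIsSide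
  have hanti : Antitone B := antitone_nat_of_succ_le fun n => by
    rw [hB]; exact Set.sdiff_subset
  have hnot' : ∀ {m n}, m ≤ n → w m ∉ B n := fun {m n} hmn hm => (hside m).notMem (hanti hmn hm)
  have hinj : Function.Injective w := by
    have hlt : ∀ m n, m < n → w m ≠ w n := fun m n hmn heq => by
      obtain ⟨n, rfl⟩ : ∃ k, n = k + 1 := ⟨n - 1, by omega⟩
      exact hnot' (Nat.lt_succ_iff.1 hmn) (heq ▸ hwB n)
    intro m n heq
    by_contra hmn
    rcases Nat.lt_or_gt_of_ne hmn with h' | h'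
    · exact hlt m n h' heq
    · exact hlt n m h' heq.symm
  have hstep : ∀ n, G.sideEdges (B n) = insert s(w n, w (n + 1)) (G.sideEdges (B (n + 1))) :=
    fun n => (hside n).sideEdges_eq_insert (hwB n) (hadj (σ n)) (huniq (σ n))
  have hsub : ∀ n e, e ∈ G.sideEdges (B 0) → e ∈ G.sideEdges (B n) ∨ e ∈ seqEdges w ⊤ := by
    intro n e he
    induction n with
    | zero => exact Or.inl he
    | succ n ih =>
      refine ih.elim (fun h' => ?_) Or.inr
      rw [hstep n] at h'
      exact h'.elim (fun h => Or.inr ⟨n, ENat.natCast_lt_top n, h⟩) Or.inl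
  have hinc : ∀ e ∈ G.sideEdges (B 0), ∀ i, w i ∈ e → e ∈ seqEdges w ⊤ := by
    intro e he i hi
    refine (hsub (i + 1) e he).resolve_left fun h' => ?_
    rcases (hside (i + 1)).mem_of_mem_sideEdges h' hi with h1 | h1
    · exact absurd (hinj h1) (Nat.succ_ne_self i).symm
    · exact hnot' (Nat.le_succ i) h1
  have hsupp : ∀ {x v : V} (P : G.Walk x v), x ∈ Set.range w →
      (∀ z ∈ P.support, z = c ∨ z ∈ A) → ∀ z ∈ P.support, z ∈ Set.range w := by
    intro x v P
    induction P with
    | nil => intro hx _ z hz; simp only [Walk.support_nil, List.mem_singleton] at hz; rwa [hz]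
    | @cons x y v hxy P ih =>
      intro hx hs z hz
      rw [Walk.support_cons, List.mem_cons] at hz
      rcases hz with rfl | hz
      · exact hx
      refine ih ?_ (fun z hz => hs z (by simp [hz])) z hz
      obtain ⟨i, rfl⟩ := hx
      have hor : w i ∈ A ∨ y ∈ A := by
        rcases hs (w i) (by simp) with h1 | h1
        · refine Or.inr ((hs y (by simp)).resolve_left fun h2 => ?_)
          exact hxy.ne (h1.trans h2.symm)
        · exact Or.inl h1
      obtain ⟨j, -, hj⟩ := hinc s(w i, y) (mk_mem_sideEdges.2 ⟨hxy, hor⟩) i (by simp)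
      have : y ∈ s(w j, w (j + 1)) := hj ▸ (by simp)
      rcases Sym2.mem_iff.1 this with rfl | rfl
      · exact ⟨j, rfl⟩
      · exact ⟨j + 1, rfl⟩
  refine ⟨w, rfl, hinj, Set.Subset.antisymm (fun e he => ?_) ?_⟩
  · obtain ⟨v, P, d, hP, hs, hv, hcov⟩ := h.cover [e] (by simp) (by simpa using he)
    have hr := hsupp P ⟨0, rfl⟩ hs
    rcases hcov e (by simp) with h' | rfl
    · induction e with
      | h x y =>
        obtain ⟨i, hi⟩ := hr x (P.fst_mem_support_of_mem_edges h')
        exact hinc _ he i (by simp [hi])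
    · obtain ⟨i, hi⟩ := hr v P.end_mem_support
      exact hinc _ he i (hi ▸ hv)
  · rintro e ⟨i, -, rfl⟩
    exact mk_mem_sideEdges.2 ⟨hadj (σ i), Or.inr (hanti (Nat.zero_le i) (hwB i))⟩

end SimpleGraph

theorem edgePoint_zero {V : Type*} (v w : V) : edgePoint v w 0 = vertexPoint v := by
  ext u; simp [edgePoint, vertexPoint]

theorem edgePoint_one {V : Type*} (v w : V) : edgePoint v w 1 = vertexPoint w := by
  ext u; simp [edgePoint, vertexPoint]

theorem edgePoint_symm {V : Type*} (v w : V) (t : ℝ) : edgePoint v w t = edgePoint w v (1 - t) := by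
  ext u; simp [edgePoint, add_comm]

theorem edgePoint_left {V : Type*} {v w : V} (h : v ≠ w) (t : ℝ) : edgePoint v w t v = 1 - t := by
  simp [edgePoint, h]

theorem edgePoint_right {V : Type*} {v w : V} (h : v ≠ w) (t : ℝ) : edgePoint v w t w = t := by
  simp [edgePoint, h.symm]

theorem edgePoint_of_ne {V : Type*} {v w u : V} (hv : u ≠ v) (hw : u ≠ w) (t : ℝ) :
    edgePoint v w t u = 0 := by
  simp [edgePoint, hv, hw]

theorem vertexPoint_self {V : Type*} (v : V) : vertexPoint v v = 1 := by
  simp [vertexPoint]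

theorem vertexPoint_injective {V : Type*} : Function.Injective (vertexPoint (V := V)) := by
  intro v w h
  have := congrFun h v
  rw [vertexPoint_self, vertexPoint] at this
  by_contra hvw
  simp [hvw] at this

theorem continuous_edgePoint {V : Type*} (v w : V) : Continuous (edgePoint v w) := by
  refine continuous_pi fun u => ?_
  unfold edgePoint
  split_ifs <;> fun_prop

/-- The piecewise linear curve through the vertices `w i` at the integer times `i`. -/
noncomputable def seqCurve {V : Type*} (w : ℤ → V) (s : ℝ) : V → ℝ :=
  edgePoint (w ⌊s⌋) (w (⌊s⌋ + 1)) (Int.fract s)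

theorem seqCurve_intCast {V : Type*} (w : ℤ → V) (i : ℤ) : seqCurve w i = vertexPoint (w i) := by
  simp [seqCurve, edgePoint_zero]

theorem seqCurve_of_mem_Icc {V : Type*} (w : ℤ → V) {i : ℤ} {s : ℝ} (h : (i : ℝ) ≤ s)
    (h' : s ≤ i + 1) : seqCurve w s = edgePoint (w i) (w (i + 1)) (s - i) := by
  rcases h'.eq_or_lt with rfl | h'
  · rw [add_sub_cancel_left, edgePoint_one]
    exact_mod_cast seqCurve_intCast w (i + 1)
  · have hfl : ⌊s⌋ = i := Int.floor_eq_iff.2 ⟨h, h'⟩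
    rw [seqCurve, hfl, Int.fract, hfl]

theorem continuous_seqCurve {V : Type*} (w : ℤ → V) : Continuous (seqCurve w) := by
  refine LocallyFinite.continuous (f := fun i : ℤ => Set.Icc (i : ℝ) (i + 1)) ?_ ?_
    (fun i => isClosed_Icc) (fun i => ?_)
  · intro x
    refine ⟨Set.Ioo (x - 1) (x + 1), Ioo_mem_nhds (by linarith) (by linarith),
      (Set.finite_Icc (⌊x⌋ - 2) (⌊x⌋ + 2)).subset ?_⟩
    rintro i ⟨y, ⟨h1, h2⟩, h3, h4⟩
    have h5 := Int.floor_le x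
    have h6 := Int.lt_floor_add_one x
    constructor
    · have : (⌊x⌋ : ℝ) - 2 ≤ i := by linarith
      exact_mod_cast this
    · have : (i : ℝ) < ⌊x⌋ + 2 := by linarith
      exact_mod_cast this.le
  · refine Set.eq_univ_of_forall fun s => Set.mem_iUnion.2 ⟨⌊s⌋, Int.floor_le s, ?_⟩
    exact (Int.lt_floor_add_one s).le
  · refine ContinuousOn.congr (f := fun s => edgePoint (w i) (w (i + 1)) (s - i)) ?_
      (fun s hs => seqCurve_of_mem_Icc w hs.1 hs.2)
    exact ((continuous_edgePoint _ _).comp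
      (by fun_prop : Continuous fun s : ℝ => s - i)).continuousOn

theorem exists_pos_of_mem_graphRealization {V : Type*} {G : SimpleGraph V} {x : V → ℝ}
    (hx : x ∈ GraphRealization G) : ∃ u, 0 < x u := by
  rcases hx with ⟨v, rfl⟩ | ⟨v, w, t, h, ht, rfl⟩
  · exact ⟨v, by simp [vertexPoint_self]⟩
  · rcases ht.1.eq_or_lt with rfl | h0
    · exact ⟨v, by simp [edgePoint_left h.ne]⟩
    · exact ⟨w, by simpa [edgePoint_right h.ne]⟩

theorem mk_eq_of_edgePoint_eq {V : Type*} {a b a' b' : V} {t t' : ℝ} (hab : a ≠ b)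
    (ht : t ∈ Set.Ioo (0 : ℝ) 1) (h : edgePoint a b t = edgePoint a' b' t') :
    s(a, b) = s(a', b') := by
  have key : ∀ u, u = a ∨ u = b → u = a' ∨ u = b' := by
    intro u hu
    by_contra! hno
    have h0 := congrFun h u
    rw [edgePoint_of_ne hno.1 hno.2] at h0
    rcases hu with rfl | rfl
    · rw [edgePoint_left hab] at h0; linarith [ht.2]
    · rw [edgePoint_right hab] at h0; linarith [ht.1]
  have ha := key a (Or.inl rfl)
  have hb := key b (Or.inr rfl)
  rw [Sym2.eq_iff]
  grind

theorem seqCurve_eq_iff {V : Type*} {w : ℤ → V} {E : Set ℤ} {J : Set ℝ}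
    (hJ : ∀ s, s ∈ J ↔ ∃ i ∈ E, (i : ℝ) ≤ s ∧ s ≤ i + 1)
    (hne : ∀ i ∈ E, w i ≠ w (i + 1))
    (hinj : ∀ i ∈ E, ∀ j ∈ E, s(w i, w (i + 1)) = s(w j, w (j + 1)) → i = j)
    {s t : ℝ} (hs : s ∈ J) (ht : t ∈ J) :
    seqCurve w s = seqCurve w t ↔ s = t ∨ ∃ i j : ℤ, s = i ∧ t = j ∧ w i = w j := by
  have key : ∀ s ∈ J, (∃ i : ℤ, s = i) ∨ ∃ i ∈ E, ∃ r ∈ Set.Ioo (0 : ℝ) 1, s = i + r ∧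
      seqCurve w s = edgePoint (w i) (w (i + 1)) r := by
    intro s hs
    obtain ⟨i, hi, h1, h2⟩ := (hJ s).1 hs
    rcases h1.eq_or_lt with h1' | h1'
    · exact Or.inl ⟨i, h1'.symm⟩
    rcases h2.eq_or_lt with h2' | h2'
    · exact Or.inl ⟨i + 1, by push_cast; exact h2'⟩
    · exact Or.inr ⟨i, hi, s - i, ⟨by linarith, by linarith⟩, by ring, seqCurve_of_mem_Icc w h1 h2⟩
  have mixed : ∀ (i : ℤ), ∀ j ∈ E, ∀ r ∈ Set.Ioo (0 : ℝ) 1,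
      vertexPoint (w i) ≠ edgePoint (w j) (w (j + 1)) r := by
    intro i j hj r hr h
    have h1 := congrFun h (w i)
    rw [vertexPoint_self] at h1
    by_cases hij : w i = w j
    · rw [hij, edgePoint_left (hne j hj)] at h1; linarith [hr.1]
    by_cases hij' : w i = w (j + 1)
    · rw [hij', edgePoint_right (hne j hj)] at h1; linarith [hr.2]
    · rw [edgePoint_of_ne hij hij'] at h1; norm_num at h1
  constructor
  · intro h
    rcases key s hs with ⟨i, rfl⟩ | ⟨i, hi, r, hr, hsr, hs'⟩ <;>
      rcases key t ht with ⟨j, rfl⟩ | ⟨j, hj, r', hr', htr, ht'⟩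
    · rw [seqCurve_intCast, seqCurve_intCast] at h
      exact Or.inr ⟨i, j, rfl, rfl, vertexPoint_injective h⟩
    · rw [seqCurve_intCast, ht'] at h
      exact absurd h (mixed i j hj r' hr')
    · rw [seqCurve_intCast, hs'] at h
      exact absurd h.symm (mixed j i hi r hr)
    · rw [hs', ht'] at h
      obtain rfl := hinj i hi j hj (mk_eq_of_edgePoint_eq (hne i hi) hr h)
      have h1 := congrFun h (w i)
      rw [edgePoint_left (hne i hi), edgePoint_left (hne i hi)] at h1
      left; linarith
  · rintro (rfl | ⟨i, j, rfl, rfl, hij⟩)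
    · rfl
    · rw [seqCurve_intCast, seqCurve_intCast, hij]

theorem exists_isTraversal_graphRealization {V : Type*} {G : SimpleGraph V} {w : ℤ → V} {E : Set ℤ}
    {J : Set ℝ} (hE : E.Nonempty) (hJ : ∀ s, s ∈ J ↔ ∃ i ∈ E, (i : ℝ) ≤ s ∧ s ≤ i + 1)
    (hedge : ∀ e, e ∈ G.edgeSet ↔ ∃ i ∈ E, e = s(w i, w (i + 1)))
    (hinj : ∀ i ∈ E, ∀ j ∈ E, s(w i, w (i + 1)) = s(w j, w (j + 1)) → i = j)
    (hv : ∀ v, ∃ u, G.Adj v u)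
    (hfin : ∀ u, ∃ N : ℝ, ∀ i ∈ E, w i = u ∨ w (i + 1) = u → |(i : ℝ)| ≤ N) :
    ∃ f : ℝ → GraphRealization G, IsTraversal J f ∧ ∀ s ∈ J, ∀ t ∈ J,
      (f s = f t ↔ s = t ∨ ∃ i j : ℤ, s = i ∧ t = j ∧ w i = w j) := by
  classical
  have hadj : ∀ i ∈ E, G.Adj (w i) (w (i + 1)) := fun i hi => (hedge _).2 ⟨i, hi, rfl⟩
  have hmem : ∀ s ∈ J, seqCurve w s ∈ GraphRealization G := by
    intro s hs
    obtain ⟨i, hi, h1, h2⟩ := (hJ s).1 hs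
    rw [seqCurve_of_mem_Icc w h1 h2]
    exact Or.inr ⟨_, _, _, hadj i hi, ⟨by linarith, by linarith⟩, rfl⟩
  obtain ⟨i₀, hi₀⟩ := hE
  have h₀ : (i₀ : ℝ) ∈ J := (hJ _).2 ⟨i₀, hi₀, le_rfl, by linarith⟩
  let f : ℝ → GraphRealization G := fun s =>
    if h : s ∈ J then ⟨seqCurve w s, hmem s h⟩ else ⟨seqCurve w i₀, hmem _ h₀⟩
  have hf : ∀ s ∈ J, (f s : V → ℝ) = seqCurve w s := fun s hs => by simp [f, hs]
  have hon : ∀ i ∈ E, ∀ r ∈ Set.Icc (0 : ℝ) 1, ∃ s ∈ J,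
      (f s : V → ℝ) = edgePoint (w i) (w (i + 1)) r := by
    intro i hi r hr
    have hs : (i : ℝ) + r ∈ J := (hJ _).2 ⟨i, hi, by linarith [hr.1], by linarith [hr.2]⟩
    refine ⟨_, hs, ?_⟩
    rw [hf _ hs, seqCurve_of_mem_Icc w (i := i) (by linarith [hr.1]) (by linarith [hr.2]),
      add_sub_cancel_left]
  have hon' : ∀ v u, G.Adj v u → ∀ r ∈ Set.Icc (0 : ℝ) 1, ∃ s ∈ J,
      (f s : V → ℝ) = edgePoint v u r := by
    intro v u h r hr
    obtain ⟨i, hi, he⟩ := (hedge s(v, u)).1 h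
    rcases Sym2.eq_iff.1 he with ⟨rfl, rfl⟩ | ⟨rfl, rfl⟩
    · exact hon i hi r hr
    · rw [edgePoint_symm]
      exact hon i hi (1 - r) ⟨by linarith [hr.2], by linarith [hr.1]⟩
  refine ⟨f, ⟨?_, ?_, ?_⟩, ?_⟩
  · rw [Topology.IsInducing.subtypeVal.continuousOn_iff]
    exact (continuous_seqCurve w).continuousOn.congr fun s hs => hf s hs
  · rintro ⟨x, hx⟩
    suffices h : ∃ s ∈ J, (f s : V → ℝ) = x by
      obtain ⟨s, hs, h⟩ := h
      exact ⟨s, hs, Subtype.ext h⟩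
    rcases hx with ⟨v, rfl⟩ | ⟨v, u, t, h, ht, rfl⟩
    · obtain ⟨u, hu⟩ := hv v
      rw [← edgePoint_zero v u]
      exact hon' v u hu 0 (by simp)
    · exact hon' v u h t ht
  · rintro ⟨x, hx⟩
    obtain ⟨u, hu⟩ := exists_pos_of_mem_graphRealization hx
    obtain ⟨N, hN⟩ := hfin u
    refine ⟨{y | 0 < (y : V → ℝ) u}, (isOpen_lt continuous_const
      ((continuous_apply u).comp continuous_subtype_val)).mem_nhds hu, N + 1, fun s hs hsu => ?_⟩
    obtain ⟨i, hi, h1, h2⟩ := (hJ s).1 hs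
    have hpos : 0 < (f s : V → ℝ) u := hsu
    rw [hf s hs, seqCurve_of_mem_Icc w h1 h2] at hpos
    have hor : w i = u ∨ w (i + 1) = u := by
      by_contra! hno
      rw [edgePoint_of_ne hno.1.symm hno.2.symm] at hpos
      exact lt_irrefl _ hpos
    have := abs_le.1 (hN i hi hor)
    exact abs_le.2 ⟨by linarith, by linarith⟩
  · intro s hs t ht
    rw [← seqCurve_eq_iff hJ (fun i hi => (hadj i hi).ne) hinj hs ht, Subtype.ext_iff, hf s hs,
      hf t ht]

namespace SimpleGraph

variable {V : Type*} {G : SimpleGraph V} {c : V} {A B : Set V}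

/-- The side `A` of `c` is traversed by the vertex sequence `w` of length `m`, the only possible
repetition being `w k = w m`. -/
structure IsSpine (G : SimpleGraph V) (c : V) (A : Set V) (w : ℕ → V) (k m : ℕ∞) : Prop where
  zero : w 0 = c
  pos : m ≠ 0
  le : k = m ∨ ∃ a b : ℕ, k = a ∧ m = b ∧ a + 3 ≤ b
  eq_iff : ∀ i j : ℕ, (i : ℕ∞) ≤ m → (j : ℕ∞) ≤ m →
    (w i = w j ↔ i = j ∨ (((i : ℕ∞) = k ∨ (i : ℕ∞) = m) ∧ ((j : ℕ∞) = k ∨ (j : ℕ∞) = m)))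
  edges : G.sideEdges A = seqEdges w m

theorem seqEdges_zero (w : ℕ → V) : seqEdges w 0 = ∅ := by
  simp [seqEdges]

theorem IsFinSide.isSpine {w : ℕ → V} {n : ℕ} (h : IsFinSide G c A w n)
    (hne : (G.sideEdges A).Nonempty) : IsSpine G c A w n n where
  zero := h.zero
  pos h0 := by
    rw [h.edges, h0, seqEdges_zero] at hne
    exact Set.not_nonempty_empty hne
  le := Or.inl rfl
  eq_iff i j hi hj := by
    norm_cast at *
    constructor
    · exact fun hw => Or.inl (h.injOn hi hj hw)
    · rintro (rfl | ⟨h1, h2⟩)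
      · rfl
      · congr 1; omega
  edges := h.edges

theorem IsRaySide.isSpine {w : ℕ → V} (h : IsRaySide G c A w) : IsSpine G c A w ⊤ ⊤ where
  zero := h.zero
  pos := ENat.top_ne_zero
  le := Or.inl rfl
  eq_iff i j _ _ := by simp [h.inj.eq_iff]
  edges := h.edges

theorem IsLoopSide.isSpine {w : ℕ → V} {k n : ℕ} (h : IsLoopSide G c A w k n) :
    IsSpine G c A w k n where
  zero := h.zero
  pos := by have := h.le; norm_cast; omega
  le := Or.inr ⟨k, n, rfl, rfl, h.le⟩
  eq_iff i j hi hj := by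
    norm_cast at *
    have hle := h.le
    have hkn := h.eq
    have key : ∀ i < n, ∀ j < n, w i = w j → i = j := fun i hi j hj hw => h.injOn hi hj hw
    rcases hi.lt_or_eq with hi | rfl <;> rcases hj.lt_or_eq with hj | rfl
    · constructor
      · exact fun hw => Or.inl (key i hi j hj hw)
      · grind
    · rw [hkn]
      constructor
      · intro hw
        have := key i hi k (by omega) hw
        omega
      · grind
    · rw [hkn]
      constructor
      · intro hw
        have := key k (by omega) j hj hw
        omega
      · grind
    · simp
  edges := h.edges

theorem IsSpine.edge_injective {w : ℕ → V} {k m : ℕ∞} (h : IsSpine G c A w k m) {i j : ℕ}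
    (hi : (i : ℕ∞) < m) (hj : (j : ℕ∞) < m) (he : s(w i, w (i + 1)) = s(w j, w (j + 1))) :
    i = j := by
  have hi' : ((i + 1 : ℕ) : ℕ∞) ≤ m := by exact_mod_cast Order.add_one_le_of_lt hi
  have hj' : ((j + 1 : ℕ) : ℕ∞) ≤ m := by exact_mod_cast Order.add_one_le_of_lt hj
  rw [Sym2.eq_iff, h.eq_iff i j hi.le hj.le, h.eq_iff _ _ hi' hj', h.eq_iff _ _ hi.le hj',
    h.eq_iff _ _ hi' hj.le] at he
  rcases h.le with rfl | ⟨a, b, rfl, rfl, hab⟩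
  · simp only [hi.ne, hj.ne] at he
    grind
  · norm_cast at *
    omega

/-- Two sequences of vertices that start at a common vertex, combined into one two-sided
sequence. -/
def twoSided (wA wB : ℕ → V) (i : ℤ) : V := if 0 ≤ i then wB i.toNat else wA (-i).toNat

theorem twoSided_natCast (wA wB : ℕ → V) (i : ℕ) : twoSided wA wB i = wB i := by
  simp [twoSided]

theorem twoSided_neg_natCast {wA wB : ℕ → V} (h : wA 0 = wB 0) (i : ℕ) :
    twoSided wA wB (-i) = wA i := by
  rcases Nat.eq_zero_or_pos i with rfl | hi
  · simp [twoSided, h]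
  · simp [twoSided]
    omega

/-- The real numbers marking an endpoint of the closing edge of a spine. -/
def IsMark (k m : ℕ∞) (s : ℝ) : Prop := ∃ n : ℕ, s = n ∧ ((n : ℕ∞) = k ∨ (n : ℕ∞) = m)

theorem isMark_natCast {k m : ℕ∞} {n : ℕ} :
    IsMark k m n ↔ (n : ℕ∞) = k ∨ (n : ℕ∞) = m := by
  simp [IsMark]

theorem IsSpine.le_length {w : ℕ → V} {k m : ℕ∞} (h : IsSpine G c A w k m) : k ≤ m := by
  rcases h.le with rfl | ⟨a, b, rfl, rfl, hab⟩
  · rfl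
  · norm_cast; omega

theorem IsSpine.le_of_isMark {w : ℕ → V} {k m : ℕ∞} (h : IsSpine G c A w k m) {n : ℕ}
    (hn : (n : ℕ∞) = k ∨ (n : ℕ∞) = m) : (n : ℕ∞) ≤ m := by
  rcases hn with hn | hn
  · exact hn.le.trans h.le_length
  · exact hn.le

theorem IsSpine.eq_root_iff {w : ℕ → V} {k m : ℕ∞} (h : IsSpine G c A w k m) {i : ℕ}
    (hi : (i : ℕ∞) ≤ m) : w i = c ↔ (i : ℝ) = 0 ∨ (k = 0 ∧ IsMark k m i) := by
  rw [← h.zero, h.eq_iff i 0 hi (by simp), isMark_natCast]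
  have := h.pos
  constructor
  · rintro (h1 | ⟨h1, h2 | h2⟩)
    · exact Or.inl (by exact_mod_cast h1)
    · exact Or.inr ⟨by simpa using h2.symm, h1⟩
    · exact absurd h2.symm (by simpa using this)
  · rintro (h1 | ⟨h1, h2⟩)
    · exact Or.inl (by exact_mod_cast h1)
    · exact Or.inr ⟨h2, Or.inl (by simp [h1])⟩

theorem IsSpine.exists_bound {w : ℕ → V} {k m : ℕ∞} (h : IsSpine G c A w k m) (u : V) :
    ∃ N : ℕ, ∀ i : ℕ, (i : ℕ∞) ≤ m → w i = u → i ≤ N := by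
  by_cases hm : m = ⊤
  · have hk : k = ⊤ := by
      rcases h.le with h1 | ⟨a, b, -, hb, -⟩
      · exact h1.trans hm
      · exact absurd (hb.symm.trans hm) (ENat.natCast_ne_top b)
    by_cases hu : ∃ i, w i = u
    · obtain ⟨i, rfl⟩ := hu
      refine ⟨i, fun j _ hj => ?_⟩
      rw [h.eq_iff j i (by simp [hm]) (by simp [hm])] at hj
      simp [hk, hm] at hj
      exact hj.le
    · exact ⟨0, fun i _ hi => absurd ⟨i, hi⟩ hu⟩
  · lift m to ℕ using hm
    exact ⟨m, fun i hi _ => by exact_mod_cast hi⟩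

/-- The real interval `[-mA, mB]`. -/
def realSpan (mA mB : ℕ∞) : Set ℝ :=
  {s | (∀ n : ℕ, mA = n → -(n : ℝ) ≤ s) ∧ ∀ n : ℕ, mB = n → s ≤ n}

theorem natCast_mem_realSpan {mA mB : ℕ∞} {n : ℕ} : (n : ℝ) ∈ realSpan mA mB ↔ (n : ℕ∞) ≤ mB := by
  constructor
  · rintro ⟨-, h⟩
    induction mB using ENat.recTopCoe with
    | top => simp
    | coe b => exact_mod_cast h b rfl
  · refine fun h => ⟨fun k _ => ?_, ?_⟩
    · have h1 : (0 : ℝ) ≤ k := k.cast_nonneg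
      have h2 : (0 : ℝ) ≤ n := n.cast_nonneg
      linarith
    · rintro k rfl
      exact_mod_cast h

theorem neg_natCast_mem_realSpan {mA mB : ℕ∞} {n : ℕ} :
    -(n : ℝ) ∈ realSpan mA mB ↔ (n : ℕ∞) ≤ mA := by
  rw [← natCast_mem_realSpan (mA := mB)]
  constructor
  · exact fun h => ⟨fun k hk => by linarith [h.2 k hk], fun k hk => by linarith [h.1 k hk]⟩
  · exact fun h => ⟨fun k hk => by linarith [h.2 k hk], fun k hk => by linarith [h.1 k hk]⟩

theorem mem_realSpan_iff_exists_unit {mA mB : ℕ∞} (hB : mB ≠ 0) (s : ℝ) : s ∈ realSpan mA mB ↔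
    ∃ i ∈ {i : ℤ | (∀ n : ℕ, mA = n → -(n : ℤ) ≤ i) ∧ ∀ n : ℕ, mB = n → i < n},
      (i : ℝ) ≤ s ∧ s ≤ i + 1 := by
  constructor
  · rintro ⟨h1, h2⟩
    by_cases hs : mB = (⌊s⌋₊ : ℕ) ∧ s = ⌊s⌋₊
    · obtain ⟨hm, hs⟩ := hs
      have h0 : ⌊s⌋₊ ≠ 0 := by rintro h0; simp [hm, h0] at hB
      refine ⟨(⌊s⌋₊ : ℤ) - 1, ⟨fun n hn => by omega, fun n hn => ?_⟩, ?_, ?_⟩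
      · rw [hm] at hn
        norm_cast at hn
        omega
      · push_cast; linarith
      · push_cast; linarith
    · refine ⟨⌊s⌋, ⟨fun n hn => ?_, fun n hn => ?_⟩, Int.floor_le s, (Int.lt_floor_add_one s).le⟩
      · rw [Int.le_floor]
        exact_mod_cast h1 n hn
      · rw [Int.floor_lt]
        refine lt_of_le_of_ne (by exact_mod_cast h2 n hn) fun hsn => hs ?_
        have : s = n := by exact_mod_cast hsn
        subst this
        simpa using hn
  · rintro ⟨i, ⟨h1, h2⟩, h3, h4⟩
    refine ⟨fun n hn => le_trans (by exact_mod_cast h1 n hn) h3, fun n hn => h4.trans ?_⟩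
    have := h2 n hn
    exact_mod_cast this

theorem IsSpine.exists_isTraversal {wA wB : ℕ → V} {kA mA kB mB : ℕ∞}
    (hA : IsSide G c A) (hB : IsSide G c B) (hAB : Disjoint A B)
    (hE : G.edgeSet = G.sideEdges A ∪ G.sideEdges B) (hv : ∀ v, ∃ u, G.Adj v u)
    (sA : IsSpine G c A wA kA mA) (sB : IsSpine G c B wB kB mB) :
    ∃ f : ℝ → GraphRealization G, IsTraversal (realSpan mA mB) f ∧
      ∀ s ∈ realSpan mA mB, ∀ t ∈ realSpan mA mB,
        (f s = f t ↔ s = t ∨ (IsMark kA mA (-s) ∧ IsMark kA mA (-t)) ∨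
          (IsMark kB mB s ∧ IsMark kB mB t) ∨
          ((s = 0 ∨ (kA = 0 ∧ IsMark kA mA (-s)) ∨ (kB = 0 ∧ IsMark kB mB s)) ∧
           (t = 0 ∨ (kA = 0 ∧ IsMark kA mA (-t)) ∨ (kB = 0 ∧ IsMark kB mB t)))) := by
  have h0 : wA 0 = wB 0 := sA.zero.trans sB.zero.symm
  set w := twoSided wA wB with hw
  have hw1 : ∀ n : ℕ, w n = wB n := twoSided_natCast wA wB
  have hw2 : ∀ n : ℕ, w (-n) = wA n := twoSided_neg_natCast h0
  set E := {i : ℤ | (∀ n : ℕ, mA = n → -(n : ℤ) ≤ i) ∧ ∀ n : ℕ, mB = n → i < n} with hEdef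
  have hEnat : ∀ n : ℕ, (n : ℤ) ∈ E ↔ (n : ℕ∞) < mB := by
    intro n
    constructor
    · rintro ⟨-, h⟩
      induction mB using ENat.recTopCoe with
      | top => simp
      | coe b => exact_mod_cast h b rfl
    · refine fun h => ⟨fun k _ => by omega, ?_⟩
      rintro k rfl
      exact_mod_cast h
  have hEneg : ∀ n : ℕ, -(n : ℤ) - 1 ∈ E ↔ (n : ℕ∞) < mA := by
    intro n
    constructor
    · rintro ⟨h, -⟩
      induction mA using ENat.recTopCoe with
      | top => simp
      | coe b => have := h b rfl; norm_cast; omega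
    · refine fun h => ⟨?_, fun k _ => by omega⟩
      rintro k rfl
      norm_cast at h
      omega
  have hsign : ∀ i : ℤ, (∃ n : ℕ, i = n) ∨ ∃ n : ℕ, i = -(n : ℤ) - 1 := by
    intro i
    rcases le_or_gt 0 i with h | h
    · exact Or.inl ⟨i.toNat, by omega⟩
    · exact Or.inr ⟨(-i - 1).toNat, by omega⟩
  have hsign' : ∀ i : ℤ, (∃ n : ℕ, i = n) ∨ ∃ n : ℕ, i = -(n : ℤ) := by
    intro i
    rcases le_or_gt 0 i with h | h
    · exact Or.inl ⟨i.toNat, by omega⟩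
    · exact Or.inr ⟨(-i).toNat, by omega⟩
  have hpos : ∀ n : ℕ, s(w n, w (n + 1)) = s(wB n, wB (n + 1)) := fun n => by
    rw [hw1, ← hw1 (n + 1)]
    rfl
  have hneg : ∀ n : ℕ, s(w (-(n : ℤ) - 1), w (-(n : ℤ) - 1 + 1)) = s(wA n, wA (n + 1)) := by
    intro n
    rw [sub_add_cancel, hw2, ← hw2 (n + 1), Sym2.eq_swap]
    congr 3
    push_cast
    ring
  have hmemB : ∀ n : ℕ, (n : ℤ) ∈ E → s(wB n, wB (n + 1)) ∈ G.sideEdges B := fun n hn => by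
    rw [sB.edges]; exact ⟨n, (hEnat n).1 hn, rfl⟩
  have hmemA : ∀ n : ℕ, -(n : ℤ) - 1 ∈ E → s(wA n, wA (n + 1)) ∈ G.sideEdges A := fun n hn => by
    rw [sA.edges]; exact ⟨n, (hEneg n).1 hn, rfl⟩
  have hdisj : ∀ e, e ∈ G.sideEdges A → e ∈ G.sideEdges B → False := by
    rintro e he ⟨-, y, hy, hyB⟩
    rcases hA.mem_of_mem_sideEdges he hy with rfl | h
    · exact hB.notMem hyB
    · exact Set.disjoint_left.1 hAB h hyB
  have hcross : ∀ a b : ℕ, (a : ℕ∞) ≤ mA → (b : ℕ∞) ≤ mB → wA a = wB b → wA a = c ∧ wB b = c := by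
    intro a b ha hb hab
    rcases hA.seq_eq_or_mem sA.zero sA.edges ha with h | h
    · exact ⟨h, hab.symm.trans h⟩
    · rcases hB.seq_eq_or_mem sB.zero sB.edges hb with h' | h'
      · exact ⟨hab.trans h', h'⟩
      · rw [hab] at h
        exact (Set.disjoint_left.1 hAB h h').elim
  obtain ⟨f, hf, hker⟩ := exists_isTraversal_graphRealization (G := G) (w := w) (E := E)
    (J := realSpan mA mB) ⟨0, (hEnat 0).2 (by simpa using pos_iff_ne_zero.2 sB.pos)⟩
    (mem_realSpan_iff_exists_unit sB.pos)
    (by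
      intro e
      rw [hE, Set.mem_union]
      constructor
      · rintro (he | he)
        · obtain ⟨n, hn, rfl⟩ := sA.edges ▸ he
          exact ⟨_, (hEneg n).2 hn, (hneg n).symm⟩
        · obtain ⟨n, hn, rfl⟩ := sB.edges ▸ he
          exact ⟨n, (hEnat n).2 hn, (hpos n).symm⟩
      · rintro ⟨i, hi, rfl⟩
        rcases hsign i with ⟨n, rfl⟩ | ⟨n, rfl⟩
        · rw [hpos]; exact Or.inr (hmemB n hi)
        · rw [hneg]; exact Or.inl (hmemA n hi))
    (by
      intro i hi j hj hij
      rcases hsign i with ⟨n, rfl⟩ | ⟨n, rfl⟩ <;> rcases hsign j with ⟨n', rfl⟩ | ⟨n', rfl⟩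
      · rw [hpos, hpos] at hij
        rw [sB.edge_injective ((hEnat n).1 hi) ((hEnat n').1 hj) hij]
      · rw [hpos, hneg] at hij
        exact (hdisj _ (hmemA n' hj) (hij ▸ hmemB n hi)).elim
      · rw [hpos, hneg] at hij
        exact (hdisj _ (hmemA n hi) (hij ▸ hmemB n' hj)).elim
      · rw [hneg, hneg] at hij
        rw [sA.edge_injective ((hEneg n).1 hi) ((hEneg n').1 hj) hij])
    hv
    (by
      intro u
      obtain ⟨NA, hNA⟩ := sA.exists_bound u
      obtain ⟨NB, hNB⟩ := sB.exists_bound u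
      refine ⟨NA + NB + 1, fun i hi hiu => ?_⟩
      have key : |i| ≤ NA + NB + 1 := by
        rw [abs_le]
        rcases hsign i with ⟨n, rfl⟩ | ⟨n, rfl⟩
        · have hn := (hEnat n).1 hi
          rcases hiu with h | h
          · have := hNB n hn.le (by rwa [← hw1])
            omega
          · have := hNB (n + 1) (by exact_mod_cast Order.add_one_le_of_lt hn)
              (by rw [← hw1]; exact_mod_cast h)
            omega
        · have hn := (hEneg n).1 hi
          rcases hiu with h | h
          · have := hNA (n + 1) (by exact_mod_cast Order.add_one_le_of_lt hn)
              (by rw [← hw2, ← h]; congr 1; push_cast; ring)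
            omega
          · rw [sub_add_cancel, hw2] at h
            have := hNA n hn.le h
            omega
      exact_mod_cast key)
  refine ⟨f, hf, fun s hs t ht => ?_⟩
  rw [hker s hs t ht]
  have hroot : ∀ s ∈ realSpan mA mB,
      (s = 0 ∨ (kA = 0 ∧ IsMark kA mA (-s)) ∨ (kB = 0 ∧ IsMark kB mB s)) →
      ∃ i : ℤ, s = i ∧ w i = c := by
    rintro s hs (rfl | ⟨h1, n, h2, h3⟩ | ⟨h1, n, rfl, h3⟩)
    · exact ⟨0, by simp, by simpa [sB.zero] using hw1 0⟩
    · refine ⟨-n, by push_cast; linarith, ?_⟩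
      rw [hw2, sA.eq_root_iff (sA.le_of_isMark h3), isMark_natCast]
      exact Or.inr ⟨h1, h3⟩
    · refine ⟨n, by push_cast; rfl, ?_⟩
      rw [hw1, sB.eq_root_iff (sB.le_of_isMark h3), isMark_natCast]
      exact Or.inr ⟨h1, h3⟩
  constructor
  · rintro (h | ⟨i, j, rfl, rfl, hij⟩)
    · exact Or.inl h
    rcases hsign' i with ⟨a, rfl⟩ | ⟨a, rfl⟩ <;> rcases hsign' j with ⟨b, rfl⟩ | ⟨b, rfl⟩ <;>
      push_cast at hs ht ⊢ <;>
      simp only [natCast_mem_realSpan, neg_natCast_mem_realSpan] at hs ht <;>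
      simp only [hw1, hw2] at hij
    · rw [sB.eq_iff a b hs ht] at hij
      rw [isMark_natCast, isMark_natCast]
      exact hij.imp (fun h => by rw [h]) fun h => Or.inr (Or.inl h)
    · obtain ⟨h1, h2⟩ := hcross b a ht hs hij.symm
      rw [sA.eq_root_iff ht] at h1
      rw [sB.eq_root_iff hs] at h2
      rw [neg_neg, neg_eq_zero]
      tauto
    · obtain ⟨h1, h2⟩ := hcross a b hs ht hij
      rw [sA.eq_root_iff hs] at h1
      rw [sB.eq_root_iff ht] at h2
      rw [neg_neg, neg_eq_zero]
      tauto
    · rw [sA.eq_iff a b hs ht] at hij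
      rw [neg_neg, neg_neg, isMark_natCast, isMark_natCast]
      exact hij.imp (fun h => by rw [h]) fun h => Or.inl h
  · rintro (h | ⟨⟨a, ha, ha'⟩, ⟨b, hb, hb'⟩⟩ | ⟨⟨a, rfl, ha'⟩, ⟨b, rfl, hb'⟩⟩ | ⟨h1, h2⟩)
    · exact Or.inl h
    · refine Or.inr ⟨-a, -b, by push_cast; linarith, by push_cast; linarith, ?_⟩
      rw [hw2, hw2, sA.eq_iff a b (sA.le_of_isMark ha') (sA.le_of_isMark hb')]
      exact Or.inr ⟨ha', hb'⟩
    · refine Or.inr ⟨a, b, by push_cast; rfl, by push_cast; rfl, ?_⟩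
      rw [hw1, hw1, sB.eq_iff a b (sB.le_of_isMark ha') (sB.le_of_isMark hb')]
      exact Or.inr ⟨ha', hb'⟩
    · obtain ⟨i, rfl, hi⟩ := hroot s hs h1
      obtain ⟨j, rfl, hj⟩ := hroot t ht h2
      exact Or.inr ⟨i, j, rfl, rfl, hi.trans hj.symm⟩

end SimpleGraph

namespace SimpleGraph

theorem isMark_coe_coe {k n : ℕ} {s : ℝ} : IsMark k n s ↔ s = k ∨ s = n := by
  simp only [IsMark]
  norm_cast
  constructor
  · rintro ⟨m, rfl, rfl | rfl⟩ <;> simp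
  · rintro (rfl | rfl) <;> simp

theorem realSpan_coe_coe (a b : ℕ) : realSpan a b = Set.Icc (-(a : ℝ)) b := by
  ext s
  simp only [realSpan, Set.mem_ofPred_eq, Nat.cast_inj, Set.mem_Icc]
  exact ⟨fun h => ⟨h.1 a rfl, h.2 b rfl⟩,
    fun h => ⟨by rintro _ rfl; exact h.1, by rintro _ rfl; exact h.2⟩⟩

theorem realSpan_coe_top (a : ℕ) : realSpan a ⊤ = Set.Ici (-(a : ℝ)) := by
  ext s
  simp only [realSpan, Set.mem_ofPred_eq, Nat.cast_inj, Set.mem_Ici]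
  exact ⟨fun h => h.1 a rfl, fun h => ⟨by rintro _ rfl; exact h, fun n hn => by simp at hn⟩⟩

theorem realSpan_top_top : realSpan ⊤ ⊤ = Set.univ := by
  ext s
  simp [realSpan]

end SimpleGraph

/-- A space traversed by a closed set of parameters can be compared to a standard traversal after
a change of parameters. -/
theorem IsTraversal.nonempty_homeomorph_of_orderIso {X Y : Type*} [TopologicalSpace X] [T2Space X]
    [TopologicalSpace Y] [T2Space Y] {J K : Set ℝ} {f : ℝ → X} {g : ℝ → Y} (hf : IsTraversal J f)
    (hg : IsTraversal K g) (hK : IsClosed K) (e : ℝ ≃o ℝ) (hJK : ∀ s, e s ∈ J ↔ s ∈ K)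
    (h : ∀ s ∈ K, ∀ t ∈ K, f (e s) = f (e t) ↔ g s = g t) : Nonempty (X ≃ₜ Y) := by
  have := hf.comp_orderIso e
  rw [show e ⁻¹' J = K from Set.ext hJK] at this
  exact this.nonempty_homeomorph hg hK h

theorem isTraversal_projIcc : IsTraversal (Set.Icc 0 1) (Set.projIcc (0 : ℝ) 1 zero_le_one) :=
  .of_isCompact continuous_projIcc.continuousOn fun x => ⟨x, x.2, Set.projIcc_val _ x⟩

theorem isTraversal_id : IsTraversal Set.univ (id : ℝ → ℝ) where
  continuousOn := continuousOn_id
  surjOn x := ⟨x, trivial, rfl⟩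
  bounded x := ⟨Set.Icc (x - 1) (x + 1), Icc_mem_nhds (by linarith) (by linarith),
    max |x - 1| |x + 1|, fun _ _ hs => abs_le_max_abs_abs hs.1 hs.2⟩

theorem exists_isTraversal_Ico : ∃ f : ℝ → Set.Ico (0 : ℝ) 1, IsTraversal (Set.Ici 0) f ∧
    Set.InjOn f (Set.Ici 0) := by
  have hlt : ∀ s : ℝ, |s| / (1 + |s|) < 1 := fun s => by
    have := abs_nonneg s
    rw [div_lt_one (by positivity)]
    linarith
  refine ⟨fun s => ⟨|s| / (1 + |s|), by positivity, hlt s⟩, ⟨?_, fun x => ?_, fun x => ?_⟩, ?_⟩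
  · refine Continuous.continuousOn (Continuous.subtype_mk ?_ _)
    exact continuous_abs.div (by fun_prop) fun s => by positivity
  · have hx := x.2
    have h1 : 0 < 1 - (x : ℝ) := by linarith [hx.2]
    have h0 : 0 ≤ (x : ℝ) / (1 - x) := div_nonneg hx.1 h1.le
    refine ⟨x / (1 - x), h0, Subtype.ext ?_⟩
    simp only [abs_of_nonneg h0]
    field_simp
    ring
  · have h1 : (x : ℝ) < (x + 1) / 2 := by linarith [x.2.2]
    refine ⟨{y | (y : ℝ) < (x + 1) / 2},
      (isOpen_lt continuous_subtype_val continuous_const).mem_nhds h1,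
      (1 + x) / (1 - x), fun s _ hs => ?_⟩
    have hs' : |s| / (1 + |s|) < (x + 1) / 2 := hs
    have h2 : 0 < 1 - (x : ℝ) := by linarith [x.2.2]
    rw [div_lt_iff₀ (by positivity)] at hs'
    rw [le_div_iff₀ h2]
    linarith
  · intro s hs t ht hst
    have h1 : |s| / (1 + |s|) = |t| / (1 + |t|) := congrArg Subtype.val hst
    rw [abs_of_nonneg hs, abs_of_nonneg ht] at h1
    have hs' : (0 : ℝ) ≤ s := hs
    have ht' : (0 : ℝ) ≤ t := ht
    rw [div_eq_div_iff (by positivity) (by positivity)] at h1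
    linarith

namespace SimpleGraph

/-- The list of spaces in the classification. -/
def IsChainSpace (X : Type*) [TopologicalSpace X] : Prop :=
  Nonempty (X ≃ₜ Set.Icc (0 : ℝ) 1) ∨ Nonempty (X ≃ₜ Set.Ico (0 : ℝ) 1) ∨ Nonempty (X ≃ₜ ℝ) ∨
    Nonempty (X ≃ₜ lollipopSet) ∨ Nonempty (X ≃ₜ openLollipopSet) ∨
    Nonempty (X ≃ₜ dumbbellSet) ∨ Nonempty (X ≃ₜ figureEightSet)

variable {V : Type*} {G : SimpleGraph V} {c : V} {A B : Set V}

theorem isMark_unique {m : ℕ∞} {s t : ℝ} (hs : IsMark m m s)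
    (ht : IsMark m m t) : s = t := by
  obtain ⟨a, rfl, ha⟩ := hs
  obtain ⟨b, rfl, hb⟩ := ht
  rw [or_self] at ha hb
  rw [← hb] at ha
  exact_mod_cast ha

theorem IsSpine.exists_isTraversal_of_isPath {wA wB : ℕ → V} {kA mA mB : ℕ∞}
    (hA : IsSide G c A) (hB : IsSide G c B) (hAB : Disjoint A B)
    (hE : G.edgeSet = G.sideEdges A ∪ G.sideEdges B) (hv : ∀ v, ∃ u, G.Adj v u)
    (sA : IsSpine G c A wA kA mA) (sB : IsSpine G c B wB mB mB) :
    ∃ f : ℝ → GraphRealization G, IsTraversal (realSpan mA mB) f ∧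
      ∀ s ∈ realSpan mA mB, ∀ t ∈ realSpan mA mB,
        (f s = f t ↔ s = t ∨ (IsMark kA mA (-s) ∧ IsMark kA mA (-t))) := by
  obtain ⟨f, hf, hker⟩ := IsSpine.exists_isTraversal hA hB hAB hE hv sA sB
  refine ⟨f, hf, fun s hs t ht => ?_⟩
  rw [hker s hs t ht]
  have h0 : mB ≠ 0 := sB.pos
  have h1 : IsMark mB mB s → IsMark mB mB t → s = t := isMark_unique
  have h2 : kA = 0 → IsMark kA mA (-0) := fun h => ⟨0, by simp, by simp [h]⟩
  constructor
  · rintro (h | h | ⟨h, h'⟩ | ⟨h, h'⟩)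
    · exact Or.inl h
    · exact Or.inr h
    · exact Or.inl (h1 h h')
    · grind
  · tauto

theorem IsLoopSide.isChainSpace_of_isPath {wA wB : ℕ → V} {k n : ℕ} {mB : ℕ∞}
    (hA : IsSide G c A) (hB : IsSide G c B) (hAB : Disjoint A B)
    (hE : G.edgeSet = G.sideEdges A ∪ G.sideEdges B) (hv : ∀ v, ∃ u, G.Adj v u)
    (sA : IsLoopSide G c A wA k n) (sB : IsSpine G c B wB mB mB) :
    IsChainSpace (GraphRealization G) := by
  obtain ⟨f, hf, hker⟩ := IsSpine.exists_isTraversal_of_isPath hA hB hAB hE hv sA.isSpine sB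
  have hkn : (k : ℝ) + 3 ≤ n := by exact_mod_cast sA.le
  have hk0 : (0 : ℝ) ≤ k := k.cast_nonneg
  have hm := sB.pos
  simp only [isMark_coe_coe] at hker
  induction mB using ENat.recTopCoe with
  | top =>
    rw [realSpan_coe_top] at hf hker
    obtain ⟨g, hg, hgk⟩ := exists_isTraversal_openLollipop
    obtain ⟨e, e0, e1, -, -⟩ := exists_orderIso_real (a := -(n : ℝ)) (b := -k) (c := 1) (d := 2)
      (by linarith) (by linarith) (by norm_num)
    have hJ : ∀ s, e s ∈ Set.Ici (-(n : ℝ)) ↔ s ∈ Set.Ici 0 := fun s => by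
      rw [← e0]; simp
    refine Or.inr (Or.inr (Or.inr (Or.inr (Or.inl
      (hf.nonempty_homeomorph_of_orderIso hg isClosed_Ici e hJ fun s hs t ht => ?_)))))
    rw [hker _ ((hJ s).2 hs) _ ((hJ t).2 ht), hgk s hs t ht]
    simp only [neg_eq_iff_eq_neg, ← e0, ← e1, EmbeddingLike.apply_eq_iff_eq]
    tauto
  | coe n' =>
    rw [realSpan_coe_coe] at hf hker
    have hn' : (0 : ℝ) < n' := by
      norm_cast at *
      omega
    obtain ⟨g, hg, hgk⟩ := exists_isTraversal_lollipop
    obtain ⟨e, e0, e1, e2, -⟩ := exists_orderIso_real (a := -(n : ℝ)) (b := -k) (c := n')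
      (d := n' + 1) (by linarith) (by linarith) (by norm_num)
    have hJ : ∀ s, e s ∈ Set.Icc (-(n : ℝ)) n' ↔ s ∈ Set.Icc 0 2 := fun s => by
      rw [← e0, ← e2]; simp
    refine Or.inr (Or.inr (Or.inr (Or.inl
      (hf.nonempty_homeomorph_of_orderIso hg isClosed_Icc e hJ fun s hs t ht => ?_))))
    rw [hker _ ((hJ s).2 hs) _ ((hJ t).2 ht), hgk s hs t ht]
    simp only [neg_eq_iff_eq_neg, ← e0, ← e1, EmbeddingLike.apply_eq_iff_eq]
    tauto

theorem IsLoopSide.isChainSpace {wA wB : ℕ → V} {k n k' n' : ℕ}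
    (hA : IsSide G c A) (hB : IsSide G c B) (hAB : Disjoint A B)
    (hE : G.edgeSet = G.sideEdges A ∪ G.sideEdges B) (hv : ∀ v, ∃ u, G.Adj v u)
    (sA : IsLoopSide G c A wA k n) (sB : IsLoopSide G c B wB k' n') :
    IsChainSpace (GraphRealization G) := by
  obtain ⟨f, hf, hker⟩ := IsSpine.exists_isTraversal hA hB hAB hE hv sA.isSpine sB.isSpine
  have hkn : (k : ℝ) + 3 ≤ n := by exact_mod_cast sA.le
  have hk0 : (0 : ℝ) ≤ k := k.cast_nonneg
  have hkn' : (k' : ℝ) + 3 ≤ n' := by exact_mod_cast sB.le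
  have hk0' : (0 : ℝ) ≤ k' := k'.cast_nonneg
  rw [realSpan_coe_coe] at hf hker
  simp only [isMark_coe_coe, Nat.cast_eq_zero] at hker
  by_cases hk : k = 0 ∧ k' = 0
  · obtain ⟨rfl, rfl⟩ := hk
    obtain ⟨g, hg, hgk⟩ := exists_isTraversal_figureEight
    obtain ⟨e, e0, e1, e2, -⟩ := exists_orderIso_real (a := -(n : ℝ)) (b := 0) (c := n')
      (d := n' + 1) (by linarith) (by linarith) (by norm_num)
    have hJ : ∀ s, e s ∈ Set.Icc (-(n : ℝ)) n' ↔ s ∈ Set.Icc 0 2 := fun s => by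
      rw [← e0, ← e2]; simp
    refine Or.inr (Or.inr (Or.inr (Or.inr (Or.inr (Or.inr
      (hf.nonempty_homeomorph_of_orderIso hg isClosed_Icc e hJ fun s hs t ht => ?_))))))
    rw [hker _ ((hJ s).2 hs) _ ((hJ t).2 ht), hgk s hs t ht]
    have h0 : ∀ s, -e s = n ↔ s = 0 := fun s => by rw [neg_eq_iff_eq_neg, ← e0, e.apply_eq_iff_eq]
    have h1 : ∀ s, e s = 0 ↔ s = 1 := fun s => by
      nth_rw 1 [← e1]
      rw [e.apply_eq_iff_eq]
    have h2 : ∀ s, e s = n' ↔ s = 2 := fun s => by rw [← e2, e.apply_eq_iff_eq]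
    simp only [h0, h1, h2, Nat.cast_zero, neg_eq_zero, EmbeddingLike.apply_eq_iff_eq]
    tauto
  · have hkk : -(k : ℝ) < k' := by
      norm_cast
      omega
    obtain ⟨g, hg, hgk⟩ := exists_isTraversal_dumbbell
    obtain ⟨e, e0, e1, e2, e3⟩ := exists_orderIso_real (a := -(n : ℝ)) (b := -k) (c := k')
      (d := n') (by linarith) hkk (by linarith)
    have hJ : ∀ s, e s ∈ Set.Icc (-(n : ℝ)) n' ↔ s ∈ Set.Icc 0 3 := fun s => by
      rw [← e0, ← e3]; simp
    refine Or.inr (Or.inr (Or.inr (Or.inr (Or.inr (Or.inl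
      (hf.nonempty_homeomorph_of_orderIso hg isClosed_Icc e hJ fun s hs t ht => ?_))))))
    rw [hker _ ((hJ s).2 hs) _ ((hJ t).2 ht), hgk s hs t ht]
    have h0 : ∀ s, -e s = n ↔ s = 0 := fun s => by rw [neg_eq_iff_eq_neg, ← e0, e.apply_eq_iff_eq]
    have h1 : ∀ s, -e s = k ↔ s = 1 := fun s => by rw [neg_eq_iff_eq_neg, ← e1, e.apply_eq_iff_eq]
    have h2 : ∀ s, e s = k' ↔ s = 2 := fun s => by rw [← e2, e.apply_eq_iff_eq]
    have h3 : ∀ s, e s = n' ↔ s = 3 := fun s => by rw [← e3, e.apply_eq_iff_eq]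
    have hz : ∀ s, k = 0 → e s = 0 → s = 1 := by
      rintro s rfl hs
      rw [← h1, hs]
      simp
    have hz' : ∀ s, k' = 0 → e s = 0 → s = 2 := by
      rintro s rfl hs
      rw [← h2, hs]
      simp
    have hz'' : e s = 0 → e t = 0 → s = t := fun h h' => e.injective (h.trans h'.symm)
    simp only [h0, h1, h2, h3, EmbeddingLike.apply_eq_iff_eq]
    constructor
    · rintro (h | h | h | ⟨h, h'⟩)
      · exact Or.inl h
      · exact Or.inr (Or.inl ⟨h.1.symm, h.2.symm⟩)
      · exact Or.inr (Or.inr h)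
      · have h4 := hz s
        have h5 := hz t
        have h6 := hz' s
        have h7 := hz' t
        clear * - h h' hk h4 h5 h6 h7 hz''
        grind
    · rintro (h | h | h)
      · exact Or.inl h
      · exact Or.inr (Or.inl ⟨h.1.symm, h.2.symm⟩)
      · exact Or.inr (Or.inr (Or.inl h))

theorem IsSpine.isChainSpace {wA wB : ℕ → V} {mA mB : ℕ∞}
    (hA : IsSide G c A) (hB : IsSide G c B) (hAB : Disjoint A B)
    (hE : G.edgeSet = G.sideEdges A ∪ G.sideEdges B) (hv : ∀ v, ∃ u, G.Adj v u)
    (sA : IsSpine G c A wA mA mA) (sB : IsSpine G c B wB mB mB) :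
    IsChainSpace (GraphRealization G) := by
  wlog hfin : mA = ⊤ → mB = ⊤ generalizing A B wA wB mA mB
  · exact this hB hA hAB.symm (hE.trans (Set.union_comm _ _)) sB sA fun h => by tauto
  obtain ⟨f, hf, hker⟩ := IsSpine.exists_isTraversal_of_isPath hA hB hAB hE hv sA sB
  have hker' : ∀ s ∈ realSpan mA mB, ∀ t ∈ realSpan mA mB, (f s = f t ↔ s = t) := by
    intro s hs t ht
    rw [hker s hs t ht, or_iff_left_iff_imp]
    exact fun h => neg_injective (isMark_unique h.1 h.2)
  have hA0 := sA.pos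
  have hB0 := sB.pos
  induction mA using ENat.recTopCoe with
  | top =>
    rw [hfin rfl, realSpan_top_top] at hf hker'
    exact Or.inr (Or.inr (Or.inl (hf.nonempty_homeomorph isTraversal_id isClosed_univ hker')))
  | coe a =>
    have ha : -(a : ℝ) < 0 := by
      norm_cast at *
      omega
    induction mB using ENat.recTopCoe with
    | top =>
      rw [realSpan_coe_top] at hf hker'
      obtain ⟨g, hg, hgi⟩ := exists_isTraversal_Ico
      obtain ⟨e, e0, -, -, -⟩ := exists_orderIso_real (a := -(a : ℝ)) (b := 0) (c := 1) (d := 2)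
        ha one_pos one_lt_two
      have hJ : ∀ s, e s ∈ Set.Ici (-(a : ℝ)) ↔ s ∈ Set.Ici 0 := fun s => by
        rw [← e0]; simp
      refine Or.inr (Or.inl
        (hf.nonempty_homeomorph_of_orderIso hg isClosed_Ici e hJ fun s hs t ht => ?_))
      rw [hker' _ ((hJ s).2 hs) _ ((hJ t).2 ht), hgi.eq_iff hs ht, e.apply_eq_iff_eq]
    | coe b =>
      have hb : (0 : ℝ) < b := by
        norm_cast at *
        omega
      rw [realSpan_coe_coe] at hf hker'
      obtain ⟨e, e0, e1, -, -⟩ := exists_orderIso_real (a := -(a : ℝ)) (b := b) (c := b + 1)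
        (d := b + 2) (by linarith) (by linarith) (by linarith)
      have hJ : ∀ s, e s ∈ Set.Icc (-(a : ℝ)) b ↔ s ∈ Set.Icc 0 1 := fun s => by
        rw [← e0, ← e1]; simp
      refine Or.inl (hf.nonempty_homeomorph_of_orderIso isTraversal_projIcc isClosed_Icc e hJ
        fun s hs t ht => ?_)
      rw [hker' _ ((hJ s).2 hs) _ ((hJ t).2 ht), e.apply_eq_iff_eq,
        Set.projIcc_of_mem _ hs, Set.projIcc_of_mem _ ht, Subtype.mk.injEq]

theorem PathCover.isChainSpace (hG : G.PathCover 5) (hv : ∀ v, ∃ u, G.Adj v u)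
    (h : IsSide G c A) (hA : A.Nonempty) (hB : {b | b ≠ c ∧ b ∉ A}.Nonempty) :
    IsChainSpace (GraphRealization G) := by
  set B := {b | b ≠ c ∧ b ∉ A} with hBdef
  have hBA : {b | b ≠ c ∧ b ∉ B} = A := by
    ext b
    have : b ∈ A → b ≠ c := by rintro hb rfl; exact h.notMem hb
    simp [hBdef]
    tauto
  have hB' : IsSide G c B := h.compl
  have hedge : ∀ A : Set V, A.Nonempty → (G.sideEdges A).Nonempty := by
    rintro A ⟨a, ha⟩
    obtain ⟨u, hu⟩ := hv a
    exact ⟨s(a, u), mk_mem_sideEdges.2 ⟨hu, Or.inl ha⟩⟩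
  have hEA := hedge A hA
  have hEB := hedge B hB
  have rA : RootedCover G c A := h.rootedCover hG hEB.some_mem
  have rB : RootedCover G c B := hB'.rootedCover hG (b := hEA.some)
    (by rw [hBA]; exact hEA.some_mem)
  have hdisj : Disjoint A B := Set.disjoint_left.2 fun b hb hb' => hb'.2 hb
  have hE : G.edgeSet = G.sideEdges A ∪ G.sideEdges B := by
    ext e
    induction e with
    | h x y =>
      rw [Set.mem_union, mk_mem_sideEdges, mk_mem_sideEdges, mem_edgeSet]
      refine ⟨fun hxy => ?_, by tauto⟩
      have := hxy.ne
      by_cases hx : x = c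
      · have hy : y ≠ c := fun hy => this (hx.trans hy.symm)
        simp only [hBdef, Set.mem_ofPred_eq]
        tauto
      · simp only [hBdef, Set.mem_ofPred_eq]
        tauto
  have spine : ∀ A, RootedCover G c A → (G.sideEdges A).Nonempty →
      (∃ w m, IsSpine G c A w m m) ∨ ∃ w k n, IsLoopSide G c A w k n := by
    intro A rA hEA
    by_cases hs : HasFiniteSpine G c A
    · rcases hs with ⟨w, n, hs⟩ | ⟨w, k, n, hs⟩
      · exact Or.inl ⟨w, n, hs.isSpine hEA⟩
      · exact Or.inr ⟨w, k, n, hs⟩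
    · obtain ⟨w, hw⟩ := rA.exists_isRaySide hs
      exact Or.inl ⟨w, ⊤, hw.isSpine⟩
  rcases spine A rA hEA with ⟨wA, mA, sA⟩ | ⟨wA, k, n, sA⟩ <;>
    rcases spine B rB hEB with ⟨wB, mB, sB⟩ | ⟨wB, k', n', sB⟩
  · exact sA.isChainSpace h hB' hdisj hE hv sB
  · exact sB.isChainSpace_of_isPath hB' h hdisj.symm (hE.trans (Set.union_comm _ _)) hv sA
  · exact sA.isChainSpace_of_isPath h hB' hdisj hE hv sB
  · exact sA.isChainSpace h hB' hdisj hE hv sB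

end SimpleGraph

section

variable {V : Type*} {G : SimpleGraph V} {x : V → ℝ}

theorem GraphRealization.eq_vertexPoint_or (hx : x ∈ GraphRealization G) :
    (∃ v, x = vertexPoint v) ∨
      ∃ v w t, G.Adj v w ∧ t ∈ Set.Ioo (0 : ℝ) 1 ∧ x = edgePoint v w t := by
  rcases hx with h | ⟨v, w, t, h, ht, rfl⟩
  · exact Or.inl h
  rcases ht.1.eq_or_lt with rfl | h0
  · exact Or.inl ⟨v, edgePoint_zero v w⟩
  rcases ht.2.eq_or_lt with rfl | h1
  · exact Or.inl ⟨w, edgePoint_one v w⟩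
  · exact Or.inr ⟨v, w, t, h, ⟨h0, h1⟩, rfl⟩

theorem vertexPoint_pos {v u : V} : 0 < vertexPoint v u ↔ u = v := by
  by_cases h : u = v <;> simp [vertexPoint, h]

theorem edgePoint_pos {v w u : V} (h : v ≠ w) {t : ℝ} (ht : t ∈ Set.Ioo (0 : ℝ) 1) :
    0 < edgePoint v w t u ↔ u = v ∨ u = w := by
  by_cases hv : u = v
  · subst hv; simp [edgePoint_left h, ht.2]
  by_cases hw : u = w
  · subst hw; simp [edgePoint_right h, ht.1]
  · simp [edgePoint_of_ne hv hw, hv, hw]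

theorem GraphRealization.nonneg (hx : x ∈ GraphRealization G) (u : V) : 0 ≤ x u := by
  rcases eq_vertexPoint_or hx with ⟨v, rfl⟩ | ⟨v, w, t, h, ht, rfl⟩
  · unfold vertexPoint; split_ifs <;> simp
  · unfold edgePoint; split_ifs <;> linarith [ht.1, ht.2]

theorem GraphRealization.eq_vertexPoint (hx : x ∈ GraphRealization G) {u : V} (hu : 1 ≤ x u) :
    x = vertexPoint u := by
  rcases eq_vertexPoint_or hx with ⟨v, rfl⟩ | ⟨v, w, t, h, ht, rfl⟩
  · rw [vertexPoint_pos.1 (zero_lt_one.trans_le hu)]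
  · rcases (edgePoint_pos h.ne ht).1 (zero_lt_one.trans_le hu) with rfl | rfl
    · rw [edgePoint_left h.ne] at hu; linarith [ht.1]
    · rw [edgePoint_right h.ne] at hu; linarith [ht.2]

theorem GraphRealization.of_pos_of_pos (hx : x ∈ GraphRealization G) {v w : V} (hvw : v ≠ w)
    (hv : 0 < x v) (hw : 0 < x w) :
    G.Adj v w ∧ x v + x w = 1 ∧ ∀ u, 0 < x u → u = v ∨ u = w := by
  rcases eq_vertexPoint_or hx with ⟨a, rfl⟩ | ⟨a, b, t, h, ht, rfl⟩
  · rw [vertexPoint_pos] at hv hw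
    exact absurd (hv.trans hw.symm) hvw
  · simp only [edgePoint_pos h.ne ht] at hv hw ⊢
    rcases hv with rfl | rfl <;> rcases hw with rfl | rfl
    · exact absurd rfl hvw
    · exact ⟨h, by rw [edgePoint_left h.ne, edgePoint_right h.ne]; ring, fun u hu => hu⟩
    · exact ⟨h.symm, by rw [edgePoint_left h.ne, edgePoint_right h.ne]; ring, fun u hu => hu.symm⟩
    · exact absurd rfl hvw

theorem GraphRealization.exists_pos_of_forall_lt (hx : x ∈ GraphRealization G)
    (hlt : ∀ u, x u < 1) :
    ∃ v w, v ≠ w ∧ 0 < x v ∧ 0 < x w := by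
  rcases eq_vertexPoint_or hx with ⟨v, rfl⟩ | ⟨v, w, t, h, ht, rfl⟩
  · exact absurd (hlt v) (by simp [vertexPoint_self])
  · exact ⟨v, w, h.ne, by simp [edgePoint_pos h.ne ht], by simp [edgePoint_pos h.ne ht]⟩

end

/-- An injective path in the realization of a graph. -/
structure IsArcMap {V : Type*} (G : SimpleGraph V) (γ : ℝ → V → ℝ) : Prop where
  continuous : Continuous γ
  mem : ∀ s, γ s ∈ GraphRealization G
  injOn : Set.InjOn γ (Set.Icc 0 1)

theorem NArcConn.exists_isArcMap {V : Type*} {G : SimpleGraph V} {n : ℕ}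
    (h : NArcConn (GraphRealization G) n) (S : Finset (GraphRealization G)) (hS : S.card ≤ n) :
    ∃ γ, IsArcMap G γ ∧ ∀ x ∈ S, ∃ s ∈ Set.Icc (0 : ℝ) 1, γ s = x := by
  obtain ⟨A, ⟨e⟩, hA⟩ := h S hS
  refine ⟨fun s => (e.symm (Set.projIcc 0 1 zero_le_one s) : GraphRealization G), ⟨?_, ?_, ?_⟩, ?_⟩
  · exact continuous_subtype_val.comp (continuous_subtype_val.comp
      (e.symm.continuous.comp continuous_projIcc))
  · exact fun s => Subtype.coe_prop _
  · intro s hs t ht hst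
    have := e.symm.injective (Subtype.ext (Subtype.ext hst))
    rw [Set.projIcc_of_mem _ hs, Set.projIcc_of_mem _ ht] at this
    exact congrArg Subtype.val this
  · intro x hx
    refine ⟨e ⟨x, hA hx⟩, (e ⟨x, hA hx⟩).2, ?_⟩
    simp

namespace IsArcMap

variable {V : Type*} {G : SimpleGraph V} {γ : ℝ → V → ℝ}

theorem continuous_apply (h : IsArcMap G γ) (u : V) : Continuous fun s => γ s u :=
  (_root_.continuous_apply u).comp h.continuous

theorem exists_adj (h : IsArcMap G γ) {v : V} {s : ℝ} (hs : s ∈ Set.Icc (0 : ℝ) 1)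
    (hv : γ s = vertexPoint v) : ∃ u, G.Adj v u := by
  obtain ⟨t, ht, hts⟩ : ∃ t ∈ Set.Icc (0 : ℝ) 1, t ≠ s := by
    by_cases h0 : s = 0
    · exact ⟨1, by simp, by simp [h0]⟩
    · exact ⟨0, by simp, Ne.symm h0⟩
  have hlt : γ t v < 1 := by
    by_contra! hle
    exact hts (h.injOn ht hs ((GraphRealization.eq_vertexPoint (h.mem t) hle).trans hv.symm))
  have hone : γ s v = 1 := by rw [hv, vertexPoint_self]
  obtain ⟨r, -, hr⟩ := intermediate_value_uIcc
    ((h.continuous_apply v).continuousOn (s := Set.uIcc t s))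
    (show max (γ t v) 0 / 2 + 1 / 2 ∈ Set.uIcc (γ t v) (γ s v) by
      rw [hone, Set.uIcc_of_le hlt.le]
      have := GraphRealization.nonneg (h.mem t) v
      rw [max_eq_left this]
      constructor <;> linarith)
  have h1 := GraphRealization.nonneg (h.mem t) v
  rw [max_eq_left h1] at hr
  simp only at hr
  rcases GraphRealization.eq_vertexPoint_or (h.mem r) with ⟨a, ha⟩ | ⟨a, b, q, hab, hq, ha⟩
  · rw [ha] at hr
    have h2 : v = a := vertexPoint_pos.1 (by linarith)
    rw [h2, vertexPoint_self, ← h2] at hr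
    linarith
  · have h2 : 0 < γ r v := by linarith
    rw [ha, edgePoint_pos hab.ne hq] at h2
    rcases h2 with rfl | rfl
    · exact ⟨b, hab⟩
    · exact ⟨a, hab.symm⟩

theorem finite_vertexTimes (h : IsArcMap G γ) :
    {s ∈ Set.Icc (0 : ℝ) 1 | ∃ v, 1 ≤ γ s v}.Finite := by
  have key : (Set.Icc (0 : ℝ) 1 ∩ {s ∈ Set.Icc (0 : ℝ) 1 | ∃ v, 1 ≤ γ s v}).Finite := by
    refine isCompact_Icc.induction_on
      (p := fun S => (S ∩ {s ∈ Set.Icc (0 : ℝ) 1 | ∃ v, 1 ≤ γ s v}).Finite) (by simp) ?_ ?_ ?_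
    · exact fun s t hst ht => ht.subset (Set.inter_subset_inter_left _ hst)
    · intro s t hs ht
      rw [Set.union_inter_distrib_right]
      exact hs.union ht
    · intro s _
      obtain ⟨u, hu⟩ := exists_pos_of_mem_graphRealization (h.mem s)
      refine ⟨{t | 0 < γ t u}, mem_nhdsWithin_of_mem_nhds
        ((isOpen_lt continuous_const (h.continuous_apply u)).mem_nhds hu), ?_⟩
      refine Set.Subsingleton.finite ?_
      have : ∀ t, 0 < γ t u → (∃ v, 1 ≤ γ t v) → γ t = vertexPoint u := by
        rintro t ht ⟨v, hv⟩
        have hv' := GraphRealization.eq_vertexPoint (h.mem t) hv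
        rw [hv', vertexPoint_pos] at ht
        rw [hv', ht]
      rintro t ⟨ht, ht1, ht2⟩ t' ⟨ht', ht1', ht2'⟩
      exact h.injOn ht1 ht1' ((this t ht ht2).trans (this t' ht' ht2').symm)
  exact key.subset fun s hs => ⟨hs.1, hs⟩

theorem exists_edge (h : IsArcMap G γ) {I : Set ℝ} (hI : IsPreconnected I) (hne : I.Nonempty)
    (hT : ∀ s ∈ I, ∀ v, γ s v < 1) :
    ∃ d ∈ G.edgeSet, (∀ s ∈ closure I, ∀ u, 0 < γ s u → u ∈ d) ∧
      ∀ e ∈ G.edgeSet, ∀ s ∈ I, (∀ u ∈ e, 0 < γ s u) → e = d := by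
  obtain ⟨m, hm⟩ := hne
  obtain ⟨v, w, hvw, hv, hw⟩ := GraphRealization.exists_pos_of_forall_lt (h.mem m) (hT m hm)
  have hcv := h.continuous_apply v
  have hcw := h.continuous_apply w
  have hsub : I ⊆ {s | 0 < γ s v ∧ 0 < γ s w} := by
    refine IsPreconnected.subset_left_of_subset_union (v := {s | γ s v + γ s w < 1})
      ((isOpen_lt continuous_const hcv).inter (isOpen_lt continuous_const hcw))
      (isOpen_lt (hcv.add hcw) continuous_const) ?_ ?_ ⟨m, hm, hv, hw⟩ hI
    · refine Set.disjoint_left.2 fun s hs hs' => ?_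
      exact hs'.ne (GraphRealization.of_pos_of_pos (h.mem s) hvw hs.1 hs.2).2.1
    · intro s hs
      by_cases hs1 : 0 < γ s v ∧ 0 < γ s w
      · exact Or.inl hs1
      · right
        have h1 := hT s hs v
        have h2 := hT s hs w
        change γ s v + γ s w < 1
        rw [not_and_or, not_lt, not_lt] at hs1
        rcases hs1 with hs1 | hs1 <;> linarith
  have hsum : ∀ s ∈ closure I, γ s v + γ s w = 1 := by
    intro s hs
    refine closure_minimal (t := {s | γ s v + γ s w = 1}) (fun s hs => ?_)
      (isClosed_eq (hcv.add hcw) continuous_const) hs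
    exact (GraphRealization.of_pos_of_pos (h.mem s) hvw (hsub hs).1 (hsub hs).2).2.1
  have hadj := (GraphRealization.of_pos_of_pos (h.mem m) hvw hv hw).1
  refine ⟨s(v, w), hadj, fun s hs u hu => ?_, fun e he s hs hes => ?_⟩
  · by_contra hno
    rw [Sym2.mem_iff, not_or] at hno
    have h1 := hsum s hs
    have hv0 := GraphRealization.nonneg (h.mem s) v
    rcases hv0.lt_or_eq with hv0 | hv0
    · have := GraphRealization.of_pos_of_pos (h.mem s) hno.1 hu hv0
      have hw0 : 0 < γ s w ∨ γ s w ≤ 0 := lt_or_ge _ _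
      rcases hw0 with hw0 | hw0
      · rcases this.2.2 w hw0 with h2 | h2
        · exact hno.2 h2.symm
        · exact hvw h2.symm
      · linarith [this.2.1]
    · have hw1 : 1 ≤ γ s w := by linarith
      rw [GraphRealization.eq_vertexPoint (h.mem s) hw1, vertexPoint_pos] at hu
      exact hno.2 hu
  · induction e with
    | h a b =>
      have hab : a ≠ b := G.ne_of_adj he
      have key := (GraphRealization.of_pos_of_pos (h.mem s) hvw (hsub hs).1 (hsub hs).2).2.2
      have ha := key a (hes a (by simp))
      have hb := key b (hes b (by simp))
      rw [Sym2.eq_iff]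
      grind

theorem exists_path (h : IsArcMap G γ) {b : ℝ} (hb : b ∈ Set.Icc (0 : ℝ) 1) {q : V}
    (hq : γ b = vertexPoint q) {a : ℝ} (ha : a ∈ Set.Icc (0 : ℝ) b) {p : V}
    (hp : γ a = vertexPoint p) :
    ∃ P : G.Walk p q, P.IsPath ∧ (∀ x ∈ P.support, ∃ s ∈ Set.Icc a b, γ s = vertexPoint x) ∧
      ∀ e ∈ G.edgeSet, ∀ s ∈ Set.Icc a b, (∀ u ∈ e, 0 < γ s u) → e ∈ P.edges := by
  have hnot : ∀ s v, γ s = vertexPoint v → ∀ e ∈ G.edgeSet, (∀ u ∈ e, 0 < γ s u) → False := by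
    intro s v hv e he hes
    induction e with
    | h x y =>
      have h1 := hes x (by simp)
      have h2 := hes y (by simp)
      rw [hv, vertexPoint_pos] at h1 h2
      exact G.ne_of_adj he (h1.trans h2.symm)
  set T := {s ∈ Set.Icc (0 : ℝ) 1 | ∃ v, 1 ≤ γ s v} with hT
  have hTfin : T.Finite := h.finite_vertexTimes
  induction hn : (T ∩ Set.Ioc a b).ncard using Nat.strong_induction_on generalizing a p with
  | _ n ih =>
  rcases ha.2.eq_or_lt with rfl | hab
  · obtain rfl : p = q := vertexPoint_injective (hp.symm.trans hq)
    refine ⟨.nil, by simp, fun x hx => ⟨a, by simp, ?_⟩, fun e he s hs hes => ?_⟩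
    · rw [SimpleGraph.Walk.support_nil, List.mem_singleton] at hx
      rw [hx, hp]
    · obtain rfl : s = a := le_antisymm hs.2 hs.1
      exact (hnot s p hp e he hes).elim
  · have hfin : (T ∩ Set.Ioc a b).Finite := hTfin.subset Set.inter_subset_left
    obtain ⟨a', ⟨⟨ha'1, v', hv'⟩, ha'2⟩, hmin⟩ := hfin.exists_minimal
      ⟨b, ⟨hb, q, by rw [hq, vertexPoint_self]⟩, hab, le_rfl⟩
    have hp' := GraphRealization.eq_vertexPoint (h.mem a') hv'
    obtain ⟨P, hP, hPs, hPe⟩ := ih _ (by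
      rw [← hn]
      refine Set.ncard_lt_ncard ?_ hfin
      refine (Set.ssubset_iff_of_subset ?_).2 ⟨a', ⟨⟨ha'1, v', hv'⟩, ha'2⟩, by simp⟩
      exact Set.inter_subset_inter_right _ (Set.Ioc_subset_Ioc_left ha'2.1.le))
      ⟨ha'1.1, ha'2.2⟩ hp' rfl
    obtain ⟨d, hd, hd1, hd2⟩ := h.exists_edge isPreconnected_Ioo (Set.nonempty_Ioo.2 ha'2.1)
      (fun s hs v => by
        by_contra! hsv
        have h01 : s ∈ Set.Icc (0 : ℝ) 1 := ⟨ha.1.trans hs.1.le, hs.2.le.trans ha'1.2⟩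
        have := hmin (y := s) ⟨⟨h01, v, hsv⟩, hs.1, hs.2.le.trans ha'2.2⟩ hs.2.le
        exact absurd hs.2 (not_lt.2 this))
    rw [closure_Ioo ha'2.1.ne] at hd1
    have hpd := hd1 a ⟨le_rfl, ha'2.1.le⟩ p (by rw [hp, vertexPoint_pos])
    have hpd' := hd1 a' ⟨ha'2.1.le, le_rfl⟩ v' (by rw [hp', vertexPoint_pos])
    have hne : p ≠ v' := by
      rintro rfl
      exact ha'2.1.ne (h.injOn ⟨ha.1, ha.2.trans hb.2⟩ ha'1 (hp.trans hp'.symm))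
    obtain rfl := (Sym2.mem_and_mem_iff hne).1 ⟨hpd, hpd'⟩
    rw [G.mem_edgeSet] at hd
    refine ⟨.cons hd P, ?_, fun x hx => ?_, fun e he s hs hes => ?_⟩
    · rw [SimpleGraph.Walk.cons_isPath_iff]
      refine ⟨hP, fun hmem => ?_⟩
      obtain ⟨s, hs, hsp⟩ := hPs p hmem
      have h1 : s = a := h.injOn ⟨ha'1.1.trans hs.1, hs.2.trans hb.2⟩ ⟨ha.1, ha.2.trans hb.2⟩
        (hsp.trans hp.symm)
      linarith [hs.1, ha'2.1]
    · rw [SimpleGraph.Walk.support_cons, List.mem_cons] at hx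
      rcases hx with rfl | hx
      · exact ⟨a, ⟨le_rfl, ha.2⟩, hp⟩
      · obtain ⟨s, hs, hsx⟩ := hPs x hx
        exact ⟨s, ⟨ha'2.1.le.trans hs.1, hs.2⟩, hsx⟩
    · rw [SimpleGraph.Walk.edges_cons, List.mem_cons]
      rcases lt_or_ge s a' with hsa | hsa
      · rcases hs.1.eq_or_lt with rfl | has
        · exact (hnot _ p hp e he hes).elim
        · exact Or.inl (hd2 e he s ⟨has, hsa⟩ hes)
      · exact Or.inr (hPe e he s ⟨hsa, hs.2⟩ hes)

theorem exists_pathCover (h : IsArcMap G γ) :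
    ∃ (u v : V) (P : G.Walk u v) (d₁ d₂ : Sym2 V), P.IsPath ∧ u ∈ d₁ ∧ v ∈ d₂ ∧
      ∀ e ∈ G.edgeSet, ∀ s ∈ Set.Icc (0 : ℝ) 1, (∀ u ∈ e, 0 < γ s u) →
        e ∈ P.edges ∨ e = d₁ ∨ e = d₂ := by
  set T := {s ∈ Set.Icc (0 : ℝ) 1 | ∃ v, 1 ≤ γ s v} with hT
  have hTfin : T.Finite := h.finite_vertexTimes
  have hend : ∀ I : Set ℝ, IsPreconnected I → (∀ s ∈ I, ∀ v, γ s v < 1) → ∀ (a : ℝ) (p : V),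
      γ a = vertexPoint p → (I.Nonempty → a ∈ closure I) →
      ∃ d, p ∈ d ∧ ∀ e ∈ G.edgeSet, ∀ s ∈ I, (∀ u ∈ e, 0 < γ s u) → e = d := by
    intro I hI hI1 a p hp ha
    rcases I.eq_empty_or_nonempty with rfl | hne
    · exact ⟨s(p, p), by simp, by simp⟩
    · obtain ⟨d, -, hd1, hd2⟩ := h.exists_edge hI hne hI1
      exact ⟨d, hd1 a (ha hne) p (by rw [hp, vertexPoint_pos]), hd2⟩
  rcases T.eq_empty_or_nonempty with hT0 | hT0
  · obtain ⟨d, -, -, hd2⟩ := h.exists_edge (isPreconnected_Icc (a := (0 : ℝ)) (b := 1))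
      (Set.nonempty_Icc.2 zero_le_one) (fun s hs v => by
        by_contra! hsv
        exact Set.eq_empty_iff_forall_notMem.1 hT0 s ⟨hs, v, hsv⟩)
    exact ⟨d.out.1, d.out.1, .nil, d, d, by simp, Sym2.out_fst_mem d, Sym2.out_fst_mem d,
      fun e he s hs hes => Or.inr (Or.inl (hd2 e he s hs hes))⟩
  · obtain ⟨a, ⟨ha, p, hp⟩, hmin⟩ := Set.exists_min_image T id hTfin hT0
    obtain ⟨b, ⟨hb, q, hq⟩, hmax⟩ := Set.exists_max_image T id hTfin hT0
    have hab : a ≤ b := hmin b ⟨hb, q, hq⟩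
    replace hp := GraphRealization.eq_vertexPoint (h.mem a) hp
    replace hq := GraphRealization.eq_vertexPoint (h.mem b) hq
    obtain ⟨P, hP, -, hPe⟩ := h.exists_path hb hq ⟨ha.1, hab⟩ hp
    obtain ⟨d₁, hd₁, hd₁'⟩ := hend (Set.Ico 0 a) isPreconnected_Ico
      (fun s hs v => by
        by_contra! hsv
        exact absurd hs.2 (not_lt.2 (hmin s ⟨⟨hs.1, hs.2.le.trans ha.2⟩, v, hsv⟩))) a p hp
      (fun hne => by
        rw [closure_Ico (Set.nonempty_Ico.1 hne).ne]
        exact ⟨ha.1, le_rfl⟩)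
    obtain ⟨d₂, hd₂, hd₂'⟩ := hend (Set.Ioc b 1) isPreconnected_Ioc
      (fun s hs v => by
        by_contra! hsv
        exact absurd hs.1 (not_lt.2 (hmax s ⟨⟨hb.1.trans hs.1.le, hs.2⟩, v, hsv⟩))) b q hq
      (fun hne => by
        rw [closure_Ioc (Set.nonempty_Ioc.1 hne).ne]
        exact ⟨le_rfl, hb.2⟩)
    refine ⟨p, q, P, d₁, d₂, hP, hd₁, hd₂, fun e he s hs hes => ?_⟩
    rcases lt_or_ge s a with hsa | hsa
    · exact Or.inr (Or.inl (hd₁' e he s ⟨hs.1, hsa⟩ hes))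
    rcases lt_or_ge b s with hsb | hsb
    · exact Or.inr (Or.inr (hd₂' e he s ⟨hsb, hs.2⟩ hes))
    · exact Or.inl (hPe e he s ⟨hsa, hsb⟩ hes)

end IsArcMap

theorem NArcConn.pathCover {V : Type*} {G : SimpleGraph V} {n : ℕ}
    (h : NArcConn (GraphRealization G) n) : G.PathCover n := by
  classical
  intro l hl hlE
  have hmid : ∀ e ∈ l, ∃ x : GraphRealization G, ∀ u ∈ e, 0 < (x : V → ℝ) u := by
    intro e he
    have := hlE e he
    induction e with
    | h v w =>
      refine ⟨⟨edgePoint v w (1 / 2), Or.inr ⟨v, w, 1 / 2, this, by norm_num, rfl⟩⟩, fun u hu => ?_⟩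
      exact (edgePoint_pos (G.ne_of_adj this) (by norm_num)).2 (Sym2.mem_iff.1 hu)
  choose m hm using hmid
  have hcard : (l.attach.map fun e : {e // e ∈ l} => m e.1 e.2).toFinset.card ≤ n :=
    (List.toFinset_card_le _).trans (by simpa using hl)
  obtain ⟨γ, hγ, hS⟩ := h.exists_isArcMap _ hcard
  obtain ⟨u, v, P, d₁, d₂, hP, hu, hv, hcov⟩ := hγ.exists_pathCover
  refine ⟨u, v, P, d₁, d₂, hP, hu, hv, fun e he => ?_⟩
  obtain ⟨s, hs, hse⟩ := hS (m e he) (by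
    simp only [List.mem_toFinset, List.mem_map]
    exact ⟨⟨e, he⟩, by simp, rfl⟩)
  exact hcov e (hlE e he) s hs fun u hu => by rw [hse]; exact hm e he u hu

theorem NArcConn.exists_adj {V : Type*} {G : SimpleGraph V} {n : ℕ} (hn : 1 ≤ n)
    (h : NArcConn (GraphRealization G) n) (v : V) : ∃ u, G.Adj v u := by
  obtain ⟨γ, hγ, hS⟩ := h.exists_isArcMap {⟨vertexPoint v, Or.inl ⟨v, rfl⟩⟩} (by simpa)
  obtain ⟨s, hs, hsv⟩ := hS _ (Finset.mem_singleton_self _)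
  exact hγ.exists_adj hs hsv

theorem SimpleGraph.isChainSpace_of_forall_eq_or {V : Type*} {G : SimpleGraph V} {x y : V}
    (hxy : ∀ z, z = x ∨ z = y) (hv : ∀ v, ∃ u, G.Adj v u) :
    IsChainSpace (GraphRealization G) := by
  have hadj : G.Adj x y := by
    obtain ⟨u, hu⟩ := hv x
    rcases hxy u with rfl | rfl
    · exact absurd hu (G.irrefl)
    · exact hu
  obtain ⟨f, hf, hker⟩ := exists_isTraversal_graphRealization (G := G)
    (w := fun i => if i = 0 then x else y) (E := {0}) (J := Set.Icc 0 1) ⟨0, rfl⟩ (by simp)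
    (by
      intro e
      simp only [Set.mem_singleton_iff, exists_eq_left]
      induction e with
      | h a b =>
        rw [G.mem_edgeSet]
        constructor
        · intro hab
          have := hab.ne
          have h1 := hxy a
          have h2 := hxy b
          simp
          grind
        · simp
          rintro (⟨rfl, rfl⟩ | ⟨rfl, rfl⟩)
          · exact hadj
          · exact hadj.symm)
    (by rintro _ rfl _ rfl _; rfl) hv (fun u => ⟨0, by simp⟩)
  refine Or.inl (hf.nonempty_homeomorph isTraversal_projIcc isClosed_Icc fun s hs t ht => ?_)
  rw [hker s hs t ht, Set.projIcc_of_mem _ hs, Set.projIcc_of_mem _ ht, Subtype.mk.injEq,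
    or_iff_left_iff_imp]
  rintro ⟨i, j, rfl, rfl, hij⟩
  have hi : 0 ≤ i ∧ i ≤ 1 := ⟨by exact_mod_cast hs.1, by exact_mod_cast hs.2⟩
  have hj : 0 ≤ j ∧ j ≤ 1 := ⟨by exact_mod_cast ht.1, by exact_mod_cast ht.2⟩
  have := hadj.ne
  norm_cast
  split_ifs at hij <;> first | omega | (exfalso; grind)

theorem NArcConn.isChainSpace {V : Type*} {G : SimpleGraph V} (hcyc : ¬ CyclicallyConnected G)
    (h : NArcConn (GraphRealization G) 5) : SimpleGraph.IsChainSpace (GraphRealization G) := by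
  have hv := h.exists_adj (by norm_num)
  by_cases h3 : ∀ x y : V, ∃ z, z ≠ x ∧ z ≠ y
  · obtain ⟨c, A, hc, hA, ⟨b, hb⟩, hclosed⟩ := exists_separation hcyc h3
    exact h.pathCover.isChainSpace hv ⟨hc, hclosed⟩ hA ⟨b, hb⟩
  · push Not at h3
    obtain ⟨x, y, hxy⟩ := h3
    exact SimpleGraph.isChainSpace_of_forall_eq_or (fun z => or_iff_not_imp_left.2 (hxy z)) hv

theorem SimpleGraph.IsChainSpace.nArcConn {X : Type*} [TopologicalSpace X]
    (h : SimpleGraph.IsChainSpace X) (n : ℕ) : NArcConn X n := by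
  rcases h with ⟨⟨e⟩⟩ | ⟨⟨e⟩⟩ | ⟨⟨e⟩⟩ | ⟨⟨e⟩⟩ | ⟨⟨e⟩⟩ | ⟨⟨e⟩⟩ | ⟨⟨e⟩⟩
  · exact (nArcConn_coe_real Set.ordConnected_Icc (p := 0) (q := 1) (by simp) (by simp)
      one_pos n).of_homeomorph e
  · exact (nArcConn_coe_real Set.ordConnected_Ico (p := 0) (q := 1 / 2) (by simp) (by norm_num)
      (by norm_num) n).of_homeomorph e
  · exact (nArcConn_real n).of_homeomorph e
  · exact (nArcConn_lollipop n).of_homeomorph e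
  · exact (nArcConn_openLollipop n).of_homeomorph e
  · exact (nArcConn_dumbbell n).of_homeomorph e
  · exact (nArcConn_figureEight n).of_homeomorph e

/-- A graph `G` that is not cyclically connected is 5-arc connected iff
`|G|` is homeomorphic to one of: the closed interval, the half-open interval, the real
line, the lollipop, the lollipop minus its free endpoint, the dumbbell, or the
figure-eight. -/
theorem statement11 {V : Type*} (G : SimpleGraph V) (hcyc : ¬ CyclicallyConnected G) :
    NArcConn ↥(GraphRealization G) 5 ↔
      (Nonempty (↥(GraphRealization G) ≃ₜ ↥(Set.Icc (0 : ℝ) 1)) ∨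
       Nonempty (↥(GraphRealization G) ≃ₜ ↥(Set.Ico (0 : ℝ) 1)) ∨
       Nonempty (↥(GraphRealization G) ≃ₜ ℝ) ∨
       Nonempty (↥(GraphRealization G) ≃ₜ ↥lollipopSet) ∨
       Nonempty (↥(GraphRealization G) ≃ₜ ↥openLollipopSet) ∨
       Nonempty (↥(GraphRealization G) ≃ₜ ↥dumbbellSet) ∨
       Nonempty (↥(GraphRealization G) ≃ₜ ↥figureEightSet)) := by
  exact ⟨fun h => h.isChainSpace hcyc, fun h => SimpleGraph.IsChainSpace.nArcConn h 5⟩
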